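/- arXiv:0809.0663 — 8 statements merged into one kernel-verified Lean document; each statement's English description precedes it below -/
import Mathlib

section
/- Let r, m be natural numbers and let F_1, …, F_m ∈ ℤ[X_1, …, X_r]. Suppose that there are infinitely many prime numbers p such that the reductions of F_1, …, F_m modulo p have a common zero in 𝔽̄_p^r. Then F_1, …, F_m have a common zero in ℂ^r. -/
open MvPolynomial in
/-- An ideal of `ℤ[X]` (finitely many variables) containing no nonzero integer has a zero over
any algebraically closed field of characteristic zero. -/
theorem MvPolynomial.exists_aeval_eq_zero_of_forall_C_mem {σ K : Type*} [Finite σ] [Field K]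
    [CharZero K] [IsAlgClosed K] (I : Ideal (MvPolynomial σ ℤ))
    (hI : ∀ n : ℤ, C n ∈ I → n = 0) : ∃ x : σ → K, ∀ f ∈ I, aeval x f = 0 := by
  let := algebraMvPolynomial (σ := σ) (R := ℤ) (S := ℚ)
  have hne : I.map (algebraMap (MvPolynomial σ ℤ) (MvPolynomial σ ℚ)) ≠ ⊤ := by
    rw [IsLocalization.map_algebraMap_ne_top_iff_disjoint ((nonZeroDivisors ℤ).map C)]
    rw [Set.disjoint_left]
    rintro _ ⟨n, hn, rfl⟩ hnI
    exact nonZeroDivisors.ne_zero hn (hI n hnI)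
  obtain ⟨M, hM, hIM⟩ := Ideal.exists_le_maximal _ hne
  let := Ideal.Quotient.field M
  have : Module.Finite ℚ (MvPolynomial σ ℚ ⧸ M) := finite_of_finite_type_of_isJacobsonRing _ _
  let φ : (MvPolynomial σ ℚ ⧸ M) →ₐ[ℚ] K := IsAlgClosed.lift
  let ψ : MvPolynomial σ ℤ →ₐ[ℤ] K :=
    ((φ.toRingHom.comp (Ideal.Quotient.mk M)).comp
      (MvPolynomial.map (Int.castRingHom ℚ))).toIntAlgHom
  refine ⟨fun i => ψ (X i), fun f hf => ?_⟩
  have hψ : aeval (fun i => ψ (X i)) = ψ := (aeval_unique ψ).symm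
  rw [hψ]
  have : Ideal.Quotient.mk M (MvPolynomial.map (Int.castRingHom ℚ) f) = 0 :=
    Ideal.Quotient.eq_zero_iff_mem.2 (hIM (Ideal.mem_map_of_mem _ hf))
  change φ (Ideal.Quotient.mk M (MvPolynomial.map (Int.castRingHom ℚ) f)) = 0
  rw [this, map_zero]


/-- If a finite family of integer polynomials has, for infinitely many primes `p`,
a common zero over the algebraic closure of `𝔽_p` (after reducing coefficients mod `p`),
then it has a common zero over `ℂ`. -/
theorem common_zero_over_C_of_common_zero_mod_infinitely_many_primes
    (r m : ℕ) (F : Fin m → MvPolynomial (Fin r) ℤ)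
    (h : {p : ℕ | ∃ _ : Fact p.Prime,
        ∃ x : Fin r → AlgebraicClosure (ZMod p),
          ∀ i, MvPolynomial.eval x
            (MvPolynomial.map (Int.castRingHom (AlgebraicClosure (ZMod p))) (F i)) = 0}.Infinite) :
    ∃ x : Fin r → ℂ,
      ∀ i, MvPolynomial.eval x (MvPolynomial.map (Int.castRingHom ℂ) (F i)) = 0 := by
  obtain ⟨x, hx⟩ := MvPolynomial.exists_aeval_eq_zero_of_forall_C_mem (K := ℂ)
    (Ideal.span (Set.range F)) fun n hn => by
      by_contra hn0
      refine h (n.natAbs.divisors.finite_toSet.subset ?_)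
      rintro p ⟨_, x, hx⟩
      have hle : Ideal.span (Set.range F) ≤ RingHom.ker (MvPolynomial.aeval (R := ℤ) x) := by
        rw [Ideal.span_le]
        rintro _ ⟨i, rfl⟩
        simpa [MvPolynomial.eval_map, MvPolynomial.aeval_def,
          RingHom.ext_int (algebraMap ℤ (AlgebraicClosure (ZMod p))) (Int.castRingHom _)] using hx i
      have hn' : (n : AlgebraicClosure (ZMod p)) = 0 := by simpa using hle hn
      have := (CharP.intCast_eq_zero_iff (AlgebraicClosure (ZMod p)) p n).1 hn'
      simpa [hn0] using Int.natCast_dvd.1 this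
  refine ⟨x, fun i => ?_⟩
  simpa [MvPolynomial.eval_map, MvPolynomial.aeval_def] using
    hx (F i) (Ideal.subset_span ⟨i, rfl⟩)
end

section
/- Let K be a number field with ring of integers 𝓞_K, and let F_1, …, F_m ∈ 𝓞_K[X_1, …, X_r]. Suppose that there are infinitely many prime numbers p for which there exists a ring homomorphism φ : 𝓞_K → 𝔽̄_p such that the polynomials obtained from F_1, …, F_m by applying φ to their coefficients have a common zero in 𝔽̄_p^r. Then F_1, …, F_m have a common zero in K̄^r, where K̄ is an algebraic closure of K. -/
open NumberField

/-- Polynomials over a domain without a common zero over an algebraically closed extension of its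
fraction field generate an ideal containing a nonzero constant. -/
theorem exists_ne_zero_C_mem_span_of_forall_not_common_zero
    {A K L σ ι : Type*} [CommRing A] [IsDomain A] [Field K] [Algebra A K] [IsFractionRing A K]
    [Field L] [Algebra K L] [IsAlgClosed L] [Finite σ] (F : ι → MvPolynomial σ A)
    (h : ¬ ∃ x : σ → L, ∀ i, MvPolynomial.eval x
      (MvPolynomial.map ((algebraMap K L).comp (algebraMap A K)) (F i)) = 0) :
    ∃ d : A, d ≠ 0 ∧ MvPolynomial.C d ∈ Ideal.span (Set.range F) := by
  let := MvPolynomial.algebraMvPolynomial (R := A) (S := K) (σ := σ)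
  let J : Ideal (MvPolynomial σ K) :=
    (Ideal.span (Set.range F)).map (algebraMap (MvPolynomial σ A) (MvPolynomial σ K))
  have hempty : MvPolynomial.zeroLocus L J = ∅ := by
    refine Set.eq_empty_iff_forall_notMem.2 fun x hx ↦ h ⟨x, fun i ↦ ?_⟩
    have hi := hx _ (Ideal.mem_map_of_mem _ (Ideal.subset_span (Set.mem_range_self i)))
    rwa [MvPolynomial.algebraMap_def, MvPolynomial.aeval_def, ← MvPolynomial.eval_map,
      MvPolynomial.map_map] at hi
  have htop : J = ⊤ := by
    rw [← Ideal.radical_eq_top, ← MvPolynomial.vanishingIdeal_zeroLocus_eq_radical (K := L),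
      hempty, MvPolynomial.vanishingIdeal_empty]
  have hdisj := mt (IsLocalization.map_algebraMap_ne_top_iff_disjoint
    ((nonZeroDivisors A).map MvPolynomial.C) (MvPolynomial σ K) (Ideal.span (Set.range F))).2
    (not_not.2 htop)
  obtain ⟨_, ⟨d, hd, rfl⟩, hmem⟩ := Set.not_disjoint_iff.1 hdisj
  exact ⟨d, nonZeroDivisors.ne_zero hd, hmem⟩

/-- A ring homomorphism vanishes on every constant in the ideal generated by polynomials that
acquire a common zero through it. -/
theorem map_eq_zero_of_C_mem_span_of_common_zero
    {A B σ ι : Type*} [CommRing A] [CommRing B] {F : ι → MvPolynomial σ A} {d : A}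
    (hd : MvPolynomial.C d ∈ Ideal.span (Set.range F)) (φ : A →+* B) (x : σ → B)
    (hx : ∀ i, MvPolynomial.eval x (MvPolynomial.map φ (F i)) = 0) : φ d = 0 := by
  have hle : Ideal.span (Set.range F) ≤
      RingHom.ker ((MvPolynomial.eval x).comp (MvPolynomial.map φ)) := by
    rw [Ideal.span_le]
    rintro _ ⟨i, rfl⟩
    exact hx i
  simpa using RingHom.mem_ker.1 (hle hd)

/-- A nonzero algebraic integer is killed only by homomorphisms to rings whose characteristic
divides the absolute norm of the ideal it generates. -/
theorem dvd_absNorm_span_of_map_eq_zero {K B : Type*} [Field K] [NumberField K] [CommRing B]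
    (p : ℕ) [CharP B p] (φ : 𝓞 K →+* B) {d : 𝓞 K} (h : φ d = 0) :
    p ∣ Ideal.absNorm (Ideal.span {d}) := by
  obtain ⟨c, hc⟩ := Ideal.mem_span_singleton'.1 (Ideal.absNorm_mem (Ideal.span {d}))
  rw [← CharP.cast_eq_zero_iff B p, ← map_natCast φ, ← hc, map_mul, h, mul_zero]

/-- If a finite family of polynomials over the ring of integers of a number field `K` has,
for infinitely many primes `p`, a common zero over `𝔽̄_p` after applying some ring homomorphism
`𝓞 K → 𝔽̄_p` to coefficients, then it has a common zero over an algebraic closure of `K`. -/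
theorem common_zero_over_Kbar_of_common_zero_mod_infinitely_many_primes
    (K : Type*) [Field K] [NumberField K]
    (r m : ℕ) (F : Fin m → MvPolynomial (Fin r) (𝓞 K))
    (h : {p : ℕ | ∃ _ : Fact p.Prime,
        ∃ φ : 𝓞 K →+* AlgebraicClosure (ZMod p),
          ∃ x : Fin r → AlgebraicClosure (ZMod p),
            ∀ i, MvPolynomial.eval x (MvPolynomial.map φ (F i)) = 0}.Infinite) :
    ∃ x : Fin r → AlgebraicClosure K,
      ∀ i, MvPolynomial.eval x
        (MvPolynomial.map
          ((algebraMap K (AlgebraicClosure K)).comp (algebraMap (𝓞 K) K)) (F i)) = 0 := by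
  by_contra hF
  obtain ⟨d, hd, hmem⟩ := exists_ne_zero_C_mem_span_of_forall_not_common_zero F hF
  have hN : Ideal.absNorm (Ideal.span {d}) ≠ 0 := by
    rwa [Ne, Ideal.absNorm_eq_zero_iff, Ideal.span_singleton_eq_bot]
  refine h ((Nat.divisors (Ideal.absNorm (Ideal.span {d}))).finite_toSet.subset ?_)
  rintro p ⟨_, φ, x, hx⟩
  have : CharP (AlgebraicClosure (ZMod p)) p :=
    charP_of_injective_algebraMap (algebraMap (ZMod p) _).injective p
  exact Nat.mem_divisors.2 ⟨dvd_absNorm_span_of_map_eq_zero p φ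
    (map_eq_zero_of_C_mem_span_of_common_zero hmem φ x hx), hN⟩
end

section
/- Let F_1, …, F_m ∈ ℤ[X_1, …, X_r]. If F_1, …, F_m have a common zero in ℂ^r, then for all but finitely many prime numbers p the reductions of F_1, …, F_m modulo p have a common zero in 𝔽̄_p^r. -/
open FirstOrder FirstOrder.Language FirstOrder.Ring FirstOrder.Field

/-- Evaluating the element of the free commutative ring corresponding to an integer polynomial
amounts to evaluating the polynomial. -/
theorem FreeCommRing.lift_freeCommRingEquivMvPolynomialInt_symm {σ K : Type*} [CommRing K]
    (x : σ → K) (f : MvPolynomial σ ℤ) :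
    FreeCommRing.lift x ((freeCommRingEquivMvPolynomialInt σ).symm f) =
      MvPolynomial.eval x (MvPolynomial.map (Int.castRingHom K) f) := by
  obtain ⟨g, rfl⟩ := (freeCommRingEquivMvPolynomialInt σ).surjective f
  rw [RingEquiv.symm_apply_apply]
  have hom_eq : FreeCommRing.lift x = ((MvPolynomial.eval x).comp
      (MvPolynomial.map (Int.castRingHom K))).comp
        (freeCommRingEquivMvPolynomialInt σ : FreeCommRing σ →+* MvPolynomial σ ℤ) := by
    ext
    simp [freeCommRingEquivMvPolynomialInt]
  exact DFunLike.congr_fun hom_eq g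

/-- The sentence in the language of rings saying that a finite family of integer polynomials has a
common zero. -/
noncomputable def commonZeroSentence {ι σ : Type} [Finite ι] [Finite σ]
    (F : ι → MvPolynomial σ ℤ) : Language.ring.Sentence :=
  Formula.iExs σ (Formula.iInf fun i ↦
    ((termOfFreeCommRing ((freeCommRingEquivMvPolynomialInt σ).symm (F i))).relabel Sum.inr).equal
      (0 : Language.ring.Term (Empty ⊕ σ)))

theorem realize_commonZeroSentence {ι σ : Type} [Finite ι] [Finite σ]
    (F : ι → MvPolynomial σ ℤ) (K : Type*) [CommRing K] [CompatibleRing K] :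
    K ⊨ commonZeroSentence F ↔ ∃ x : σ → K,
      ∀ i, MvPolynomial.eval x (MvPolynomial.map (Int.castRingHom K) (F i)) = 0 := by
  simp [Sentence.Realize, commonZeroSentence, Formula.realize_iExs, Formula.realize_iInf,
    Formula.realize_equal, Function.comp_def,
    FreeCommRing.lift_freeCommRingEquivMvPolynomialInt_symm]

/-- Over an algebraically closed field, solvability of a system of integer polynomial equations
depends only on the theory of algebraically closed fields of the given characteristic. -/
theorem ACF_models_commonZeroSentence_iff {ι σ : Type} [Finite ι] [Finite σ]
    (F : ι → MvPolynomial σ ℤ) {p : ℕ} (hp : p.Prime ∨ p = 0)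
    (K : Type) [Field K] [IsAlgClosed K] [CharP K p] :
    Theory.ACF p ⊨ᵇ commonZeroSentence F ↔ ∃ x : σ → K,
      ∀ i, MvPolynomial.eval x (MvPolynomial.map (Int.castRingHom K) (F i)) = 0 := by
  let _ := compatibleRingOfRing K
  rw [← (ACF_isComplete hp).realize_sentence_iff _ K, realize_commonZeroSentence]


/-- If a finite family of integer polynomials has a common zero over `ℂ`, then for all but
finitely many primes `p` the reductions modulo `p` have a common zero over `𝔽̄_p`. -/
theorem common_zero_mod_p_for_almost_all_primes_of_common_zero_over_C
    (r m : ℕ) (F : Fin m → MvPolynomial (Fin r) ℤ)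
    (h : ∃ x : Fin r → ℂ,
      ∀ i, MvPolynomial.eval x (MvPolynomial.map (Int.castRingHom ℂ) (F i)) = 0) :
    {p : ℕ | ∃ _ : Fact p.Prime,
      ¬ ∃ x : Fin r → AlgebraicClosure (ZMod p),
        ∀ i, MvPolynomial.eval x
          (MvPolynomial.map (Int.castRingHom (AlgebraicClosure (ZMod p))) (F i)) = 0}.Finite := by
  have h_zero : Theory.ACF 0 ⊨ᵇ commonZeroSentence F :=
    (ACF_models_commonZeroSentence_iff F (Or.inr rfl) ℂ).2 h
  refine ((finite_ACF_prime_not_realize_of_ACF_zero_realize _ h_zero).image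
    ((↑) : Nat.Primes → ℕ)).subset ?_
  rintro p ⟨hp, h_none⟩
  exact ⟨⟨p, hp.out⟩, fun h_models ↦ h_none
    ((ACF_models_commonZeroSentence_iff F (Or.inl hp.out) _).1 h_models), rfl⟩
end

section
/- Let A be a subring of ℂ that is finitely generated as a ℤ-algebra, and let f_1, …, f_N ∈ A[x_1, …, x_n]. Suppose f_1, …, f_N have no common zero in ℂ^n (the coefficients being regarded as complex numbers via the inclusion A ⊆ ℂ). Then there are infinitely many prime numbers p for which there exists a ring homomorphism ν : A → 𝔽̄_p such that the polynomials obtained from f_1, …, f_N by applying ν to their coefficients have no common zero in 𝔽̄_p^n. -/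
instance Int.isJacobsonRing : IsJacobsonRing ℤ := by
  rw [isJacobsonRing_iff_prime_eq]
  intro P hP
  rcases eq_or_ne P ⊥ with rfl | hne
  · refine le_antisymm (fun x hx ↦ ?_) Ideal.le_jacobson
    have hu := Ideal.mem_jacobson_bot.1 hx x
    rw [Ideal.mem_bot]
    rcases Int.isUnit_iff.1 hu with h | h <;> nlinarith
  · have := hP.isMaximal hne
    exact Ideal.jacobson_eq_self_of_isMaximal

/-- A nontrivial commutative ring of finite type over `ℤ` has a geometric point of positive
characteristic. -/
theorem exists_ringHom_algebraicClosure_zmod (B : Type*) [CommRing B] [Nontrivial B]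
    [Algebra.FiniteType ℤ B] :
    ∃ (p : ℕ) (_ : Fact p.Prime), Nonempty (B →+* AlgebraicClosure (ZMod p)) := by
  obtain ⟨m, hm⟩ := Ideal.exists_maximal B
  let : Field (B ⧸ m) := Ideal.Quotient.field m
  have : Module.Finite ℤ (B ⧸ m) := finite_of_finite_type_of_isJacobsonRing ℤ (B ⧸ m)
  rcases CharP.exists' (B ⧸ m) with h0 | ⟨p, hp, hchar⟩
  · exact absurd (isField_of_isIntegral_of_isField (FaithfulSMul.algebraMap_injective ℤ (B ⧸ m))
      (Field.toIsField _)) Int.not_isField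
  · let : Algebra (ZMod p) (B ⧸ m) := ZMod.algebra _ p
    have : Module.Finite (ZMod p) (B ⧸ m) := Module.Finite.of_restrictScalars_finite ℤ _ _
    exact ⟨p, hp, ⟨(IsAlgClosed.lift : (B ⧸ m) →ₐ[ZMod p] _).toRingHom.comp
      (Ideal.Quotient.mk m)⟩⟩

/-- Weak Nullstellensatz for a finite system of polynomials. -/
theorem MvPolynomial.exists_sum_mul_eq_one_of_no_common_zero {K σ ι : Type*} [Field K]
    [IsAlgClosed K] [Finite σ] [Fintype ι] (F : ι → MvPolynomial σ K)
    (h : ¬ ∃ x : σ → K, ∀ i, eval x (F i) = 0) : ∃ g : ι → MvPolynomial σ K, ∑ i, g i * F i = 1 := by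
  have hempty : zeroLocus K (Ideal.span (Set.range F)) = ∅ := by
    rw [zeroLocus_span, Set.eq_empty_iff_forall_notMem]
    exact fun x hx ↦ h ⟨x, fun i ↦ by simpa [aeval_eq_eval] using hx (F i) ⟨i, rfl⟩⟩
  have hrad := vanishingIdeal_zeroLocus_eq_radical (K := K) (Ideal.span (Set.range F))
  rw [hempty, vanishingIdeal_empty, eq_comm, Ideal.radical_eq_top, Ideal.eq_top_iff_one] at hrad
  exact Ideal.mem_span_range_iff_exists_fun.1 hrad

/-- Spreading out: if a finite system of polynomials with coefficients in a finitely
generated `ℤ`-subalgebra `A` of `ℂ` has no common zero over `ℂ`, then for infinitely many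
primes `p` there is a ring homomorphism `ν : A → 𝔽̄_p` such that the reduced system has no
common zero over `𝔽̄_p`. -/
theorem no_common_zero_mod_infinitely_many_primes_of_no_common_zero_over_C
    (A : Subalgebra ℤ ℂ) (hA : A.FG)
    (n N : ℕ) (f : Fin N → MvPolynomial (Fin n) A)
    (h : ¬ ∃ x : Fin n → ℂ,
      ∀ i, MvPolynomial.eval x (MvPolynomial.map (algebraMap A ℂ) (f i)) = 0) :
    {p : ℕ | ∃ _ : Fact p.Prime,
      ∃ ν : A →+* AlgebraicClosure (ZMod p),
        ¬ ∃ x : Fin n → AlgebraicClosure (ZMod p),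
          ∀ i, MvPolynomial.eval x (MvPolynomial.map ν (f i)) = 0}.Infinite := by
  classical
  obtain ⟨g, hg⟩ := MvPolynomial.exists_sum_mul_eq_one_of_no_common_zero _ h
  refine Set.infinite_of_forall_exists_gt fun k ↦ ?_
  let S : Finset ℂ := insert ((k.factorial : ℂ)⁻¹) (Finset.univ.biUnion fun i ↦ (g i).coeffs)
  let B : Subalgebra ℤ ℂ := A ⊔ Algebra.adjoin ℤ (S : Set ℂ)
  have hSB : (S : Set ℂ) ⊆ B := Algebra.subset_adjoin.trans (le_sup_right (a := A))
  have : Algebra.FiniteType ℤ B :=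
    B.fg_iff_finiteType.1 (hA.sup (Subalgebra.fg_adjoin_finset S))
  obtain ⟨p, hp, ⟨ν⟩⟩ := exists_ringHom_algebraicClosure_zmod B
  let ι : A →+* B := (Subalgebra.inclusion (le_sup_left : A ≤ B)).toRingHom
  have hlift : ∀ i, ∃ q : MvPolynomial (Fin n) B, MvPolynomial.map (algebraMap B ℂ) q = g i := by
    refine fun i ↦ MvPolynomial.mem_range_map_iff_coeffs_subset.2 fun c hc ↦ ?_
    exact ⟨⟨c, hSB (Finset.mem_insert_of_mem (Finset.mem_biUnion.2 ⟨i, Finset.mem_univ i, hc⟩))⟩,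
      rfl⟩
  choose q hq using hlift
  have hone : ∑ i, q i * MvPolynomial.map ι (f i) = 1 := by
    refine MvPolynomial.map_injective (algebraMap B ℂ) Subtype.val_injective ?_
    simp only [map_sum, map_mul, map_one, hq, MvPolynomial.map_map]
    exact hg
  refine ⟨p, ⟨hp, ν.comp ι, ?_⟩, ?_⟩
  · rintro ⟨x, hx⟩
    have := congrArg (fun r ↦ MvPolynomial.eval x (MvPolynomial.map ν r)) hone
    simp [MvPolynomial.map_map, hx] at this
  · by_contra! hpk
    let u : B := ⟨(k.factorial : ℂ)⁻¹, hSB (Finset.mem_insert_self _ _)⟩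
    have hu : u * (k.factorial : B) = 1 := by
      apply Subtype.val_injective
      push_cast
      exact inv_mul_cancel₀ (by exact_mod_cast k.factorial_ne_zero)
    have hν := congrArg ν hu
    have hzero : (k.factorial : AlgebraicClosure (ZMod p)) = 0 :=
      (CharP.cast_eq_zero_iff _ p _).2 (hp.out.dvd_factorial.2 hpk)
    simp [hzero] at hν
end

section
/- Let F_1, …, F_m ∈ ℤ[X_1, …, X_r]. Let J_ℂ be the ideal of ℂ[X_1, …, X_r] generated by F_1, …, F_m, and for a prime number p let J_p be the ideal of 𝔽̄_p[X_1, …, X_r] generated by the reductions of F_1, …, F_m modulo p. Then for all but finitely many prime numbers p there exists a bijection σ from the set of minimal primes over J_ℂ in ℂ[X_1, …, X_r] to the set of minimal primes over J_p in 𝔽̄_p[X_1, …, X_r] such that for every minimal prime P over J_ℂ, the Krull dimension of ℂ[X_1, …, X_r]/P equals the Krull dimension of 𝔽̄_p[X_1, …, X_r]/σ(P). -/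
open Filter

/-- Krull dimension is invariant under injective integral ring homomorphisms. -/
theorem ringKrullDim_eq_of_injective_of_isIntegral {A B : Type*} [CommRing A] [CommRing B]
    (f : A →+* B) (hf : Function.Injective f) (hi : f.IsIntegral) :
    ringKrullDim B = ringKrullDim A := by
  let := f.toAlgebra
  have : Algebra.IsIntegral A B := ⟨hi⟩
  have : FaithfulSMul A B := (faithfulSMul_iff_algebraMap_injective A B).2 hf
  apply le_antisymm
  · refine Order.krullDim_le_of_strictMono (PrimeSpectrum.comap f) fun P Q h => ?_
    exact Ideal.IsIntegral.comap_lt_comap (R := A) (A := B) h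
  · refine iSup_le fun l => ?_
    obtain ⟨P, hP, _⟩ := Ideal.nonempty_primesOver (S := B) l.head.asIdeal
    obtain ⟨L, hL, -⟩ := Ideal.exists_ltSeries_of_hasGoingUp l P
    exact hL ▸ Order.LTSeries.length_le_krullDim L

/-- A finitely generated algebra over a field is integral over a polynomial subring, which
computes its Krull dimension. -/
theorem ringKrullDim_eq_of_injective_of_isIntegral_mvPolynomial {k B : Type*} [Field k] [CommRing B]
    {s : ℕ} (f : MvPolynomial (Fin s) k →+* B) (hf : Function.Injective f) (hi : f.IsIntegral) :
    ringKrullDim B = s := by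
  rw [ringKrullDim_eq_of_injective_of_isIntegral f hf hi,
    MvPolynomial.ringKrullDim_of_isNoetherianRing]
  simp [ringKrullDim_eq_zero_of_field]

theorem MvPolynomial.isIntegrallyClosed_fin {R : Type*} [CommRing R] [IsDomain R]
    [IsIntegrallyClosed R] (n : ℕ) : IsIntegrallyClosed (MvPolynomial (Fin n) R) := by
  induction n with
  | zero => exact IsIntegrallyClosed.of_equiv (isEmptyRingEquiv R (Fin 0)).symm
  | succ n ih => exact IsIntegrallyClosed.of_equiv (finSuccEquiv R n).symm.toRingEquiv

/-- Two ideals, possibly of different rings, have minimal primes in a dimension-preserving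
bijection. -/
def DimEquiv {R S : Type*} [CommRing R] [CommRing S] (I : Ideal R) (J : Ideal S) : Prop :=
  ∃ σ : I.minimalPrimes ≃ J.minimalPrimes,
    ∀ P : I.minimalPrimes, ringKrullDim (R ⧸ P.1) = ringKrullDim (S ⧸ (σ P).1)

namespace DimEquiv

variable {R S T : Type*} [CommRing R] [CommRing S] [CommRing T]
  {I : Ideal R} {J : Ideal S} {K : Ideal T}

theorem symm : DimEquiv I J → DimEquiv J I := fun ⟨σ, h⟩ =>
  ⟨σ.symm, fun P => by rw [h (σ.symm P), σ.apply_symm_apply]⟩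

theorem trans : DimEquiv I J → DimEquiv J K → DimEquiv I K := fun ⟨σ, h⟩ ⟨τ, h'⟩ =>
  ⟨σ.trans τ, fun P => (h P).trans (h' (σ P))⟩

theorem of_forall_exists (f : Ideal R → Ideal S)
    (hp : ∀ P ∈ I.minimalPrimes, (f P).IsPrime ∧ J ≤ f P)
    (hQ : ∀ Q : Ideal S, Q.IsPrime → J ≤ Q → ∃ P ∈ I.minimalPrimes, f P ≤ Q)
    (hinc : ∀ P ∈ I.minimalPrimes, ∀ P' ∈ I.minimalPrimes, f P ≤ f P' → P = P')
    (hd : ∀ P ∈ I.minimalPrimes, ringKrullDim (R ⧸ P) = ringKrullDim (S ⧸ f P)) :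
    DimEquiv I J := by
  have hmem : ∀ P : I.minimalPrimes, f P.1 ∈ J.minimalPrimes := by
    rintro ⟨P, hP⟩
    refine ⟨hp P hP, fun Q hQ' hle => ?_⟩
    obtain ⟨P', hP', hle'⟩ := hQ Q hQ'.1 hQ'.2
    obtain rfl := hinc P' hP' P hP (hle'.trans hle)
    exact hle'
  refine ⟨Equiv.ofBijective (fun P => ⟨f P.1, hmem P⟩) ⟨?_, ?_⟩, fun P => hd P.1 P.2⟩
  · rintro ⟨P, hP⟩ ⟨P', hP'⟩ h
    exact Subtype.ext (hinc P hP P' hP' (Subtype.ext_iff.1 h).le)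
  · rintro ⟨Q, hQ'⟩
    obtain ⟨P, hP, hle⟩ := hQ Q hQ'.1.1 hQ'.1.2
    exact ⟨⟨P, hP⟩, Subtype.ext (le_antisymm hle (hQ'.2 (hp P hP) hle))⟩

end DimEquiv

theorem RingHom.IsIntegralElem.of_square {A B A' B' : Type*} [CommRing A] [CommRing B]
    [CommRing A'] [CommRing B'] {h : A →+* B} {h' : A' →+* B'} {m : A →+* A'} {e : B →+* B'}
    (comm : h'.comp m = e.comp h) {x : B} (hx : h.IsIntegralElem x) : h'.IsIntegralElem (e x) := by
  obtain ⟨p, hp, hpx⟩ := hx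
  refine ⟨p.map m, hp.map m, ?_⟩
  rw [Polynomial.eval₂_map, comm, ← Polynomial.hom_eval₂, hpx, map_zero]

theorem MvPolynomial.isIntegral_quotient_of_forall_X {A R σ : Type*} [CommRing A] [CommRing R]
    {I : Ideal (MvPolynomial σ R)} (h : A →+* MvPolynomial σ R ⧸ I)
    (hC : ∀ a, h.IsIntegralElem (Ideal.Quotient.mk I (C a)))
    (hX : ∀ i, h.IsIntegralElem (Ideal.Quotient.mk I (X i))) : h.IsIntegral := by
  intro x
  obtain ⟨x, rfl⟩ := Ideal.Quotient.mk_surjective x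
  induction x using MvPolynomial.induction_on with
  | C a => exact hC a
  | add p q hp hq => rw [map_add]; exact hp.add h hq
  | mul_X p i hp => rw [map_mul]; exact hp.mul h (hX i)

namespace MvPolynomial

/-- Substitution of polynomials for the variables, as a ring homomorphism. -/
noncomputable def subst {R σ τ : Type*} [CommRing R] (T : τ → MvPolynomial σ R) :
    MvPolynomial τ R →+* MvPolynomial σ R :=
  eval₂Hom C T

section Subst

variable {R S σ τ : Type*} [CommRing R] [CommRing S] (T : τ → MvPolynomial σ R)

@[simp]
theorem subst_C (a : R) : subst T (C a) = C a := eval₂Hom_C _ _ _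

@[simp]
theorem subst_X (i : τ) : subst T (X i) = T i := eval₂Hom_X' _ _ _

theorem map_comp_subst (φ : R →+* S) :
    (map φ).comp (subst T) = (subst fun i => map φ (T i)).comp (map φ) :=
  ringHom_ext (by simp) (by simp)

theorem map_subst (φ : R →+* S) (f : MvPolynomial τ R) :
    map φ (subst T f) = subst (fun i => map φ (T i)) (map φ f) :=
  RingHom.congr_fun (map_comp_subst T φ) f

end Subst

/-- Noether normalization for a quotient of a polynomial ring, with lifted variables. -/
theorem exists_noether_normalization {K : Type*} [Field K] {n : ℕ}
    {P : Ideal (MvPolynomial (Fin n) K)} (hP : P ≠ ⊤) :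
    ∃ (s : ℕ) (T : Fin s → MvPolynomial (Fin n) K),
      Function.Injective ((Ideal.Quotient.mk P).comp (subst T)) ∧
      ((Ideal.Quotient.mk P).comp (subst T)).IsIntegral := by
  obtain ⟨s, -, g, hg, hi⟩ := exists_integral_inj_algHom_of_quotient P hP
  choose T hT using fun j : Fin s => Ideal.Quotient.mk_surjective (g (X j))
  have : (Ideal.Quotient.mk P).comp (subst T) = g.toRingHom := by
    refine MvPolynomial.ringHom_ext (fun r => ?_) fun j => ?_
    · rw [RingHom.comp_apply, subst_C]
      exact (g.commutes r).symm
    · simp [hT]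
  exact ⟨s, T, by rw [this]; exact hg, by rw [this]; exact hi⟩

end MvPolynomial

namespace MvPolynomial

section FieldExtension

variable {K L : Type*} [Field K] [Field L] [Algebra K L] {σ τ : Type*}

/-- Apply a linear functional to all coefficients of a polynomial. -/
noncomputable def mapCoeff (l : L →ₗ[K] K) : MvPolynomial σ L →+ MvPolynomial σ K :=
  ((basisMonomials σ K).repr.symm.toAddMonoidHom.comp (Finsupp.mapRange.addMonoidHom
    l.toAddMonoidHom)).comp (basisMonomials σ L).repr.toAddMonoidHom

theorem coeff_mapCoeff (l : L →ₗ[K] K) (f : MvPolynomial σ L) (d : σ →₀ ℕ) :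
    coeff d (mapCoeff l f) = l (coeff d f) := by
  rfl

theorem mapCoeff_monomial (l : L →ₗ[K] K) (d : σ →₀ ℕ) (a : L) :
    mapCoeff l (monomial d a) = monomial d (l a) := by
  classical
  ext e
  rw [coeff_mapCoeff, coeff_monomial, coeff_monomial]
  split_ifs <;> simp

theorem mapCoeff_map_mul (l : L →ₗ[K] K) (h : MvPolynomial σ K) (f : MvPolynomial σ L) :
    mapCoeff l (map (algebraMap K L) h * f) = h * mapCoeff l f := by
  classical
  ext d
  rw [coeff_mapCoeff, coeff_mul, coeff_mul, map_sum]
  refine Finset.sum_congr rfl fun x _ => ?_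
  rw [coeff_map, ← Algebra.smul_def, map_smul, smul_eq_mul, coeff_mapCoeff]

theorem mapCoeff_map (l : L →ₗ[K] K) (h : MvPolynomial σ K) :
    mapCoeff l (map (algebraMap K L) h) = h * C (l 1) := by
  have := mapCoeff_map_mul l h 1
  rw [mul_one] at this
  rw [this, ← C_1, C_apply, mapCoeff_monomial, C_apply]

theorem apply_eval_algebraMap (l : L →ₗ[K] K) (x : σ → K) (f : MvPolynomial σ L) :
    l (eval (fun i => algebraMap K L (x i)) f) = eval x (mapCoeff l f) := by
  induction f using MvPolynomial.induction_on' with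
  | add p q h1 h2 => rw [map_add, map_add, map_add, map_add, h1, h2]
  | monomial d a =>
    rw [mapCoeff_monomial, eval_monomial, eval_monomial]
    have : (d.prod fun n e => algebraMap K L (x n) ^ e) = algebraMap K L (d.prod fun n e => x n ^ e) := by
      simp [map_finsuppProd]
    rw [this, mul_comm, ← Algebra.smul_def, map_smul, smul_eq_mul, mul_comm]

theorem mapCoeff_subst (l : L →ₗ[K] K) (T : τ → MvPolynomial σ K) (f : MvPolynomial τ L) :
    mapCoeff l (subst (fun i => map (algebraMap K L) (T i)) f) = subst T (mapCoeff l f) := by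
  induction f using MvPolynomial.induction_on' with
  | add p q h1 h2 => simp only [map_add, h1, h2]
  | monomial d a =>
    have hC : ∀ c : L, mapCoeff l (C c : MvPolynomial σ L) = C (l c) := fun c => by
      rw [C_apply, mapCoeff_monomial, C_apply]
    have : subst (fun i => map (algebraMap K L) (T i)) (monomial d a) =
        map (algebraMap K L) (d.prod fun i e => T i ^ e) * C a := by
      rw [subst, coe_eval₂Hom, eval₂_monomial, mul_comm]
      simp [map_finsuppProd]
    rw [this, mapCoeff_map_mul, hC, mapCoeff_monomial, subst, coe_eval₂Hom, eval₂_monomial, mul_comm]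

theorem mem_map_iff_forall_mapCoeff_mem {P : Ideal (MvPolynomial σ K)} {f : MvPolynomial σ L} :
    f ∈ P.map (map (algebraMap K L)) ↔ ∀ l : L →ₗ[K] K, mapCoeff l f ∈ P := by
  classical
  constructor
  · intro hf l
    induction hf using Submodule.span_induction generalizing l with
    | mem x hx =>
      obtain ⟨h, hh, rfl⟩ := hx
      rw [mapCoeff_map]
      exact P.mul_mem_right _ hh
    | zero => simp
    | add x y _ _ hx hy => rw [map_add]; exact P.add_mem (hx l) (hy l)
    | smul a x _ hx =>
      rw [smul_eq_mul]
      induction a using MvPolynomial.induction_on' generalizing l with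
      | add p q h1 h2 => rw [add_mul, map_add]; exact P.add_mem (h1 l) (h2 l)
      | monomial d c =>
        have h1 : monomial d c * x = map (algebraMap K L) (monomial d 1) * (C c * x) := by
          rw [← mul_assoc, map_monomial, map_one, mul_comm (monomial d 1), C_mul_monomial, mul_one]
        have h2 : mapCoeff l (C c * x) = mapCoeff (l ∘ₗ LinearMap.mulLeft K c) x := by
          ext e
          simp [coeff_mapCoeff]
        rw [h1, mapCoeff_map_mul, h2]
        exact P.mul_mem_left _ (hx _)
  · intro h
    let b := Module.Free.chooseBasis K L
    let S := f.support.biUnion fun d => (b.repr (coeff d f)).support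
    have : f = ∑ i ∈ S, C (b i) * map (algebraMap K L) (mapCoeff (b.coord i) f) := by
      ext d
      rw [coeff_sum]
      simp only [coeff_C_mul, coeff_map, coeff_mapCoeff]
      by_cases hd : coeff d f = 0
      · simp [hd]
      · conv_lhs => rw [← b.linearCombination_repr (coeff d f), Finsupp.linearCombination_apply]
        rw [Finsupp.sum_of_support_subset _ (s := S) (Finset.subset_biUnion_of_mem
          (fun d => (b.repr (coeff d f)).support) (mem_support_iff.2 hd)) _ (by simp)]
        simp [Algebra.smul_def, mul_comm]
    rw [this]
    exact Ideal.sum_mem _ fun i _ => Ideal.mul_mem_left _ _ (Ideal.mem_map_of_mem _ (h _))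

theorem map_mem_map_iff {P : Ideal (MvPolynomial σ K)} {h : MvPolynomial σ K} :
    map (algebraMap K L) h ∈ P.map (map (algebraMap K L)) ↔ h ∈ P := by
  refine ⟨fun hh => ?_, Ideal.mem_map_of_mem _⟩
  obtain ⟨l, hl⟩ := (Algebra.linearMap K L).exists_leftInverse_of_injective
    (LinearMap.ker_eq_bot.2 (algebraMap K L).injective)
  have h1 : l 1 = 1 := by simpa using LinearMap.congr_fun hl 1
  simpa [mapCoeff_map, h1] using mem_map_iff_forall_mapCoeff_mem.1 hh l

/-- Over an algebraically closed field, primes remain prime after a field extension. -/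
theorem isPrime_map_of_isAlgClosed [IsAlgClosed K] [Finite σ] {P : Ideal (MvPolynomial σ K)}
    (hP : P.IsPrime) : (P.map (map (algebraMap K L))).IsPrime := by
  refine ⟨fun h => hP.ne_top ?_, fun {f g} hfg => ?_⟩
  · rw [Ideal.eq_top_iff_one, ← map_mem_map_iff (L := L), map_one, h]
    trivial
  · by_contra! hcon
    simp only [mem_map_iff_forall_mapCoeff_mem, not_forall] at hcon
    obtain ⟨⟨l, hl⟩, l', hl'⟩ := hcon
    refine (hP.mem_or_mem (x := mapCoeff l f) (y := mapCoeff l' g) ?_).elim hl hl'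
    rw [← hP.radical, ← vanishingIdeal_zeroLocus_eq_radical (K := K)]
    intro x hx
    have key : ∀ h ∈ P.map (map (algebraMap K L)),
        eval (fun i => algebraMap K L (x i)) h = 0 := by
      intro h hh
      suffices P.map (map (algebraMap K L)) ≤
          RingHom.ker (eval (fun i => algebraMap K L (x i))) from this hh
      rw [Ideal.map_le_iff_le_comap]
      intro p hp
      have := hx p hp
      rw [aeval_eq_eval] at this
      rw [Ideal.mem_comap, RingHom.mem_ker, eval_map]
      exact (eval₂_comp (algebraMap K L) x p).symm.trans (by simpa using this)
    have h0 := key _ hfg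
    rw [map_mul, mul_eq_zero] at h0
    rcases h0 with h0 | h0
    · have := apply_eval_algebraMap l x f
      simp [h0] at this
      simp [← this]
    · have := apply_eval_algebraMap l' x g
      simp [h0] at this
      simp [← this]

/-- Extending scalars along an extension of an algebraically closed field preserves
irreducible components and their dimensions. -/
theorem dimEquiv_map_of_isAlgClosed [IsAlgClosed K] {n : ℕ} (J : Ideal (MvPolynomial (Fin n) K)) :
    DimEquiv J (J.map (map (algebraMap K L))) := by
  refine DimEquiv.of_forall_exists (fun P => P.map (map (algebraMap K L)))
    (fun P hP => ⟨isPrime_map_of_isAlgClosed hP.1.1, Ideal.map_mono hP.1.2⟩)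
    (fun Q hQ hJQ => ?_) (fun P hP P' hP' hle => ?_) (fun P hP => ?_)
  · obtain ⟨P, hP, hle⟩ := Ideal.exists_minimalPrimes_le (Ideal.map_le_iff_le_comap.1 hJQ)
    exact ⟨P, hP, Ideal.map_le_iff_le_comap.2 hle⟩
  · have h : P ≤ P' := fun x hx => map_mem_map_iff.1 (hle (Ideal.mem_map_of_mem _ hx))
    exact le_antisymm h (hP'.2 hP.1 h)
  · obtain ⟨s, T, hT, hi⟩ := exists_noether_normalization hP.1.1.ne_top
    rw [ringKrullDim_eq_of_injective_of_isIntegral_mvPolynomial _ hT hi]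
    let P' := P.map (map (algebraMap K L))
    let T' := fun i => map (algebraMap K L) (T i)
    symm
    refine ringKrullDim_eq_of_injective_of_isIntegral_mvPolynomial
      ((Ideal.Quotient.mk P').comp (subst T')) ?_ ?_
    · rw [injective_iff_map_eq_zero] at hT ⊢
      intro f hf
      have hf' : subst T' f ∈ P' := Ideal.Quotient.eq_zero_iff_mem.1 hf
      by_contra hne
      obtain ⟨d, hd⟩ := ne_zero_iff.1 hne
      obtain ⟨l, hl⟩ : ∃ l : L →ₗ[K] K, l (coeff d f) ≠ 0 := by
        by_contra! hl
        exact hd ((Module.forall_dual_apply_eq_zero_iff K _).1 hl)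
      refine hl ?_
      rw [← coeff_mapCoeff, hT (mapCoeff l f) ?_, coeff_zero]
      refine Ideal.Quotient.eq_zero_iff_mem.2 ?_
      have := mem_map_iff_forall_mapCoeff_mem.1 hf' l
      rwa [mapCoeff_subst] at this
    · refine isIntegral_quotient_of_forall_X _ (fun a => ?_) fun i => ?_
      · have := ((Ideal.Quotient.mk P').comp (subst T')).isIntegralElem_map (x := C a)
        rwa [RingHom.comp_apply, subst_C] at this
      · have := RingHom.IsIntegralElem.of_square (m := map (algebraMap K L))
          (h' := (Ideal.Quotient.mk P').comp (subst T'))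
          (e := Ideal.quotientMap P' (map (algebraMap K L)) Ideal.le_comap_map) ?_
          (hi (Ideal.Quotient.mk P (X i)))
        · simpa using this
        · refine MvPolynomial.ringHom_ext (fun r => ?_) fun j => ?_
          · simp
          · simp [T', P']

end FieldExtension

end MvPolynomial

/-- A place of a field with values in an algebraically closed field. -/
structure Place (K : Type*) [Field K] where
  /-- The ring of finite elements. -/
  ring : ValuationSubring K
  /-- The field of values. -/
  res : Type
  [field : Field res]
  [isAlgClosed : IsAlgClosed res]
  /-- Evaluation at the place. -/
  red : ring →+* res
  surjective_red : Function.Surjective red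

namespace Place

attribute [instance] Place.field Place.isAlgClosed

variable {K : Type*} [Field K]

/-- The filter of places generated by the conditions that an element is finite. -/
def generic (K : Type*) [Field K] : Filter (Place K) := ⨅ a : K, 𝓟 {π | a ∈ π.ring}

theorem eventually_mem (a : K) : ∀ᶠ π in generic K, a ∈ π.ring :=
  mem_iInf_of_mem a (mem_principal_self _)

theorem eventually_red_ne_zero {a : K} (ha : a ≠ 0) :
    ∀ᶠ π in generic K, ∀ b : π.ring, (b : K) = a → π.red b ≠ 0 := by
  filter_upwards [eventually_mem a⁻¹] with π h b hb
  have : b * ⟨a⁻¹, h⟩ = 1 := Subtype.ext (by simp [hb, ha])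
  exact fun h0 => one_ne_zero (α := π.res) (by rw [← map_one π.red, ← this, map_mul, h0, zero_mul])

/-- The inclusion of polynomials with finite coefficients. -/
noncomputable abbrev incl (π : Place K) (σ : Type*) :
    MvPolynomial σ π.ring →+* MvPolynomial σ K :=
  MvPolynomial.map π.ring.subtype

/-- Coefficientwise evaluation at a place. -/
noncomputable abbrev redPoly (π : Place K) (σ : Type*) :
    MvPolynomial σ π.ring →+* MvPolynomial σ π.res :=
  MvPolynomial.map π.red

variable {σ τ : Type*}

theorem incl_injective (π : Place K) : Function.Injective (π.incl σ) :=
  MvPolynomial.map_injective _ Subtype.val_injective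

theorem redPoly_surjective (π : Place K) : Function.Surjective (π.redPoly σ) :=
  MvPolynomial.map_surjective _ π.surjective_red

theorem eventually_lift (f : MvPolynomial σ K) :
    ∀ᶠ π in generic K, ∃ g, π.incl σ g = f := by
  induction f using MvPolynomial.induction_on' with
  | monomial d a =>
    filter_upwards [eventually_mem a] with π h
    exact ⟨MvPolynomial.monomial d ⟨a, h⟩, by simp [incl]⟩
  | add p q hp hq =>
    filter_upwards [hp, hq] with π ⟨p', hp⟩ ⟨q', hq⟩
    exact ⟨p' + q', by rw [map_add, hp, hq]⟩

theorem eventually_redPoly_ne_zero {f : MvPolynomial σ K} (hf : f ≠ 0) :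
    ∀ᶠ π in generic K, ∀ g, π.incl σ g = f → π.redPoly σ g ≠ 0 := by
  obtain ⟨d, hd⟩ := MvPolynomial.ne_zero_iff.1 hf
  filter_upwards [eventually_red_ne_zero hd] with π h g hg h0
  refine h (g.coeff d) ?_ ?_
  · rw [← hg, MvPolynomial.coeff_map]
    rfl
  · rw [← MvPolynomial.coeff_map]
    simp only [redPoly] at h0
    rw [h0, MvPolynomial.coeff_zero]

/-- The ideal of reductions of the polynomials with finite coefficients in an ideal. -/
noncomputable def sp (π : Place K) (I : Ideal (MvPolynomial σ K)) : Ideal (MvPolynomial σ π.res) :=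
  (I.comap (π.incl σ)).map (π.redPoly σ)

theorem mem_sp {π : Place K} {I : Ideal (MvPolynomial σ K)} {f : MvPolynomial σ π.res} :
    f ∈ π.sp I ↔ ∃ g, π.incl σ g ∈ I ∧ π.redPoly σ g = f := by
  rw [sp, Ideal.mem_map_iff_of_surjective _ π.redPoly_surjective]
  rfl

theorem redPoly_mem_sp {π : Place K} {I : Ideal (MvPolynomial σ K)} {g : MvPolynomial σ π.ring}
    (h : π.incl σ g ∈ I) : π.redPoly σ g ∈ π.sp I :=
  mem_sp.2 ⟨g, h, rfl⟩

theorem sp_mono (π : Place K) {I J : Ideal (MvPolynomial σ K)} (h : I ≤ J) : π.sp I ≤ π.sp J :=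
  Ideal.map_mono (Ideal.comap_mono h)

end Place

/-- Existence of a finite Gröbner basis with leading coefficients one. -/
theorem MonomialOrder.exists_finset_groebner {K σ : Type*} [Field K] [Finite σ]
    (m : MonomialOrder σ) (I : Ideal (MvPolynomial σ K)) :
    ∃ G : Finset (MvPolynomial σ K), (∀ g ∈ G, g ∈ I ∧ m.leadingCoeff g = 1) ∧
      ∀ f ∈ I, f ≠ 0 → ∃ g ∈ G, m.degree g ≤ m.degree f := by
  classical
  let S : Set (σ →₀ ℕ) := {d | ∃ f ∈ I, f ≠ 0 ∧ m.degree f = d}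
  have hpwo : S.IsPWO := Set.isPWO_of_wellQuasiOrderedLE S
  have hfin : {d | Minimal (· ∈ S) d}.Finite :=
    (setOfPred_minimal_antichain _).finite_of_partiallyWellOrderedOn
      (hpwo.mono (setOfPred_minimal_subset _))
  have hrep : ∀ d ∈ S, ∃ f ∈ I, m.leadingCoeff f = 1 ∧ m.degree f = d := by
    rintro _ ⟨f, hf, hf0, rfl⟩
    have hu : m.leadingCoeff f ≠ 0 := m.leadingCoeff_ne_zero_iff.2 hf0
    have hd := m.degree_smul_of_isRegular (f := f)
      (IsUnit.mk0 _ (inv_ne_zero hu)).isRegular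
    refine ⟨(m.leadingCoeff f)⁻¹ • f, I.smul_of_tower_mem _ hf, ?_, hd⟩
    rw [MonomialOrder.leadingCoeff, hd, MvPolynomial.coeff_smul]
    exact inv_mul_cancel₀ hu
  choose! r hrI hr1 hrd using hrep
  refine ⟨hfin.toFinset.image r, fun g hg => ?_, fun f hf hf0 => ?_⟩
  · obtain ⟨d, hd, rfl⟩ := Finset.mem_image.1 hg
    have := (hfin.mem_toFinset.1 hd).1
    exact ⟨hrI d this, hr1 d this⟩
  · obtain ⟨d, hle, hd⟩ := hpwo.exists_le_minimal (a := m.degree f) ⟨f, hf, hf0, rfl⟩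
    exact ⟨r d, Finset.mem_image_of_mem _ (hfin.mem_toFinset.2 hd), (hrd d hd.1).trans_le hle⟩

theorem MonomialOrder.degree_map_of_injective {R S σ : Type*} [CommSemiring R] [CommSemiring S]
    (m : MonomialOrder σ) (φ : R →+* S) (hφ : Function.Injective φ) (f : MvPolynomial σ R) :
    m.degree (MvPolynomial.map φ f) = m.degree f := by
  rw [MonomialOrder.degree, MvPolynomial.support_map_of_injective _ hφ, MonomialOrder.degree]

namespace Place

variable {K : Type*} [Field K] {σ ι : Type*}

theorem eventually_lift_mem_span {F : ι → MvPolynomial σ K} {g : MvPolynomial σ K}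
    (hg : g ∈ Ideal.span (Set.range F)) :
    ∀ᶠ π in generic K, ∀ F' : ι → MvPolynomial σ π.ring, (∀ i, π.incl σ (F' i) = F i) →
      ∃ g' ∈ Ideal.span (Set.range F'), π.incl σ g' = g := by
  induction hg using Submodule.span_induction with
  | mem x hx =>
    obtain ⟨i, rfl⟩ := hx
    exact Eventually.of_forall fun π F' h => ⟨F' i, Ideal.subset_span ⟨i, rfl⟩, h i⟩
  | zero => exact Eventually.of_forall fun π F' h => ⟨0, zero_mem _, map_zero _⟩
  | add x y _ _ hx hy =>
    filter_upwards [hx, hy] with π hx hy F' h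
    obtain ⟨x', hx', rfl⟩ := hx F' h
    obtain ⟨y', hy', rfl⟩ := hy F' h
    exact ⟨x' + y', add_mem hx' hy', map_add _ _ _⟩
  | smul a x _ hx =>
    filter_upwards [hx, eventually_lift a] with π hx ⟨a', ha⟩ F' h
    obtain ⟨x', hx', rfl⟩ := hx F' h
    exact ⟨a' * x', Ideal.mul_mem_left _ _ hx', by rw [map_mul, ha, smul_eq_mul]⟩

/-- Intersection with the polynomials with finite coefficients generically commutes with
the formation of ideals with given generators. -/
theorem eventually_comap_incl_span {n : ℕ} (F : ι → MvPolynomial (Fin n) K) :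
    ∀ᶠ π in generic K, ∀ F' : ι → MvPolynomial (Fin n) π.ring, (∀ i, π.incl _ (F' i) = F i) →
      (Ideal.span (Set.range F)).comap (π.incl _) = Ideal.span (Set.range F') := by
  let m : MonomialOrder (Fin n) := MonomialOrder.lex
  obtain ⟨G, hG, hGI⟩ := m.exists_finset_groebner (Ideal.span (Set.range F))
  have hev : ∀ᶠ π in generic K, ∀ g ∈ G, ∀ F' : ι → MvPolynomial (Fin n) π.ring,
      (∀ i, π.incl _ (F' i) = F i) → ∃ g' ∈ Ideal.span (Set.range F'), π.incl _ g' = g :=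
    (eventually_all_finset G).2 fun g hg => eventually_lift_mem_span (hG g hg).1
  filter_upwards [hev] with π hπ F' hF'
  have hle : Ideal.span (Set.range F') ≤ (Ideal.span (Set.range F)).comap (π.incl _) := by
    rw [Ideal.span_le]
    rintro _ ⟨i, rfl⟩
    exact Ideal.mem_comap.2 (hF' i ▸ Ideal.subset_span ⟨i, rfl⟩)
  refine le_antisymm (fun h hh => ?_) hle
  choose b hbF hb using fun g : G => hπ g.1 g.2 F' hF'
  have hdeg (f : MvPolynomial (Fin n) π.ring) : m.degree (π.incl _ f) = m.degree f :=
    m.degree_map_of_injective _ Subtype.val_injective f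
  have hunit : ∀ g, IsUnit (m.leadingCoeff (b g)) := fun g => by
    have : ((m.leadingCoeff (b g) : π.ring) : K) = 1 := by
      rw [← (hG g.1 g.2).2, ← hb g, MonomialOrder.leadingCoeff, MonomialOrder.leadingCoeff, hdeg,
        MvPolynomial.coeff_map]
      rfl
    rw [Subtype.ext (a1 := m.leadingCoeff (b g)) (a2 := 1) this]
    exact isUnit_one
  obtain ⟨q, r, hqr, -, hr⟩ := m.div hunit h
  have hq : Finsupp.linearCombination _ b q ∈ Ideal.span (Set.range F') := by
    rw [Finsupp.linearCombination_apply]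
    exact Ideal.sum_mem _ fun g _ => Ideal.mul_mem_left _ _ (hbF g)
  suffices r = 0 by rwa [hqr, this, add_zero]
  by_contra hr0
  have hrI : π.incl _ r ∈ Ideal.span (Set.range F) := by
    have := sub_mem hh (hle hq)
    rw [hqr, add_sub_cancel_left] at this
    exact this
  obtain ⟨g, hg, hgr⟩ := hGI _ hrI ((map_ne_zero_iff _ π.incl_injective).2 hr0)
  refine hr (m.degree r) (m.degree_mem_support hr0) ⟨g, hg⟩ ?_
  rwa [← hdeg, hb, ← hdeg r]

theorem eventually_sp_span {n : ℕ} (F : ι → MvPolynomial (Fin n) K) :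
    ∀ᶠ π in generic K, ∀ F' : ι → MvPolynomial (Fin n) π.ring, (∀ i, π.incl _ (F' i) = F i) →
      π.sp (Ideal.span (Set.range F)) = Ideal.span (Set.range fun i => π.redPoly _ (F' i)) := by
  filter_upwards [eventually_comap_incl_span F] with π h F' hF'
  rw [sp, h F' hF', Ideal.map_span, ← Set.range_comp]
  rfl

end Place

theorem RingHom.exists_isPrime_comap_eq {A B : Type*} [CommRing A] [CommRing B] (h : A →+* B)
    (hinj : Function.Injective h) (hi : h.IsIntegral) (p : Ideal A) [p.IsPrime] :
    ∃ q : Ideal B, q.IsPrime ∧ q.comap h = p := by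
  let := h.toAlgebra
  have : Algebra.IsIntegral A B := ⟨hi⟩
  have : FaithfulSMul A B := (faithfulSMul_iff_algebraMap_injective A B).2 hinj
  obtain ⟨q, hq, hq'⟩ := Ideal.nonempty_primesOver (S := B) p
  exact ⟨q, hq, hq'.over.symm⟩

theorem RingHom.exists_isPrime_le_comap_eq {A B : Type*} [CommRing A] [IsDomain A]
    [IsIntegrallyClosed A] [CommRing B] [IsDomain B] (h : A →+* B)
    (hinj : Function.Injective h) (hi : h.IsIntegral) {p : Ideal A} [p.IsPrime]
    (Q : Ideal B) [Q.IsPrime] (hp : p ≤ Q.comap h) :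
    ∃ q : Ideal B, q.IsPrime ∧ q ≤ Q ∧ q.comap h = p := by
  let := h.toAlgebra
  have : Algebra.IsIntegral A B := ⟨hi⟩
  have : FaithfulSMul A B := (faithfulSMul_iff_algebraMap_injective A B).2 hinj
  have : Q.LiesOver (Q.comap h) := ⟨rfl⟩
  obtain ⟨q, hqQ, hq, hq'⟩ := Ideal.exists_ideal_le_liesOver_of_le Q hp
  exact ⟨q, hq, hqQ, hq'.over.symm⟩

/-- Minimal primes of the reduction of a prime, for rings integral over a normal domain. -/
theorem RingHom.injective_comp_of_mem_minimalPrimes_map {A R A' R' : Type*} [CommRing A]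
    [IsDomain A] [IsIntegrallyClosed A] [CommRing R] [CommRing A'] [IsDomain A'] [CommRing R']
    {g : A →+* R} {I : Ideal R} [I.IsPrime] (hinj : Function.Injective ((Ideal.Quotient.mk I).comp g))
    (hi : ((Ideal.Quotient.mk I).comp g).IsIntegral) {ρA : A →+* A'} {ρ : R →+* R'}
    (hρA : Function.Surjective ρA) (hρ : Function.Surjective ρ) {g' : A' →+* R'}
    (comm : g'.comp ρA = ρ.comp g)
    (hker : ∀ q : Ideal R, RingHom.ker ρA ≤ q.comap g → RingHom.ker ρ ≤ q)
    {Q : Ideal R'} (hQ : Q ∈ (I.map ρ).minimalPrimes) :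
    Function.Injective ((Ideal.Quotient.mk Q).comp g') := by
  have hQp := hQ.1.1
  have hIQ : I ≤ Q.comap ρ := Ideal.map_le_iff_le_comap.1 hQ.1.2
  let Q₂ := (Q.comap ρ).map (Ideal.Quotient.mk I)
  have hQ₂ : Q₂.IsPrime := Ideal.map_isPrime_of_surjective Ideal.Quotient.mk_surjective
    (by rwa [Ideal.mk_ker])
  have hcomap : Q₂.comap (Ideal.Quotient.mk I) = Q.comap ρ := by
    rw [Ideal.comap_map_quotientMk, sup_eq_right.2 hIQ]
  have hle : RingHom.ker ρA ≤ Q₂.comap ((Ideal.Quotient.mk I).comp g) := by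
    intro f hf
    rw [← Ideal.comap_comap, hcomap, Ideal.comap_comap, ← comm, Ideal.mem_comap,
      RingHom.comp_apply, RingHom.mem_ker.1 hf, map_zero]
    exact zero_mem _
  have hp : (RingHom.ker ρA).IsPrime := RingHom.ker_isPrime _
  obtain ⟨q, hq, hqQ, hq'⟩ := RingHom.exists_isPrime_le_comap_eq _ hinj hi Q₂ hle
  let q₁ := q.comap (Ideal.Quotient.mk I)
  have hker₁ : RingHom.ker ρ ≤ q₁ := hker q₁ hq'.ge
  have hq₁ : (q₁.map ρ).IsPrime := Ideal.map_isPrime_of_surjective hρ hker₁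
  have hIq : I ≤ q₁ := fun x hx => by
    rw [Ideal.mem_comap, Ideal.Quotient.eq_zero_iff_mem.2 hx]
    exact zero_mem _
  have hq₁Q : q₁.map ρ ≤ Q :=
    Ideal.map_le_iff_le_comap.2 ((Ideal.comap_mono hqQ).trans hcomap.le)
  have hQeq := hQ.2 ⟨hq₁, Ideal.map_mono hIq⟩ hq₁Q
  rw [injective_iff_map_eq_zero]
  intro f hf
  obtain ⟨f, rfl⟩ := hρA f
  have h1 := hQeq (Ideal.Quotient.eq_zero_iff_mem.1 hf)
  rw [← RingHom.comp_apply, comm, RingHom.comp_apply, ← Ideal.mem_comap,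
    Ideal.comap_map_of_surjective _ hρ, ← RingHom.ker_eq_comap_bot, sup_eq_left.2 hker₁] at h1
  exact hq'.le h1

namespace Place

variable {K : Type*} [Field K] {σ : Type*}

theorem eventually_mem_lifts (p : Polynomial (MvPolynomial σ K)) :
    ∀ᶠ π in generic K, p ∈ Polynomial.lifts (π.incl σ) := by
  simp only [Polynomial.lifts_iff_coeff_lifts]
  filter_upwards [(eventually_all_finset p.support).2 fun i _ => eventually_lift (p.coeff i)]
    with π h i
  by_cases hi : i ∈ p.support
  · exact h i hi
  · exact ⟨0, by rw [map_zero, Polynomial.notMem_support_iff.1 hi]⟩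

section Normalization

variable {n s : ℕ} {P : Ideal (MvPolynomial (Fin n) K)} {T : Fin s → MvPolynomial (Fin n) K}

theorem comp_subst_injective_of_lift (π : Place K)
    (hT : Function.Injective ((Ideal.Quotient.mk P).comp (MvPolynomial.subst T)))
    {T' : Fin s → MvPolynomial (Fin n) π.ring} (hT' : ∀ i, π.incl _ (T' i) = T i) :
    Function.Injective ((Ideal.Quotient.mk (P.comap (π.incl _))).comp (MvPolynomial.subst T')) := by
  rw [injective_iff_map_eq_zero] at hT ⊢
  intro f hf
  refine π.incl_injective ?_
  rw [map_zero]
  refine hT _ (Ideal.Quotient.eq_zero_iff_mem.2 ?_)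
  have := Ideal.mem_comap.1 (Ideal.Quotient.eq_zero_iff_mem.1 hf)
  rwa [MvPolynomial.map_subst, funext hT'] at this

/-- The map to a quotient of the polynomial ring over the residue field. -/
noncomputable def toQuotient (π : Place K) {Q : Ideal (MvPolynomial (Fin n) π.res)}
    (hQ : π.sp P ≤ Q) :
    MvPolynomial (Fin n) π.ring ⧸ P.comap (π.incl _) →+* MvPolynomial (Fin n) π.res ⧸ Q :=
  Ideal.quotientMap Q (π.redPoly _) (Ideal.map_le_iff_le_comap.1 hQ)

theorem toQuotient_comp (π : Place K) {Q : Ideal (MvPolynomial (Fin n) π.res)}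
    (hQ : π.sp P ≤ Q) (T' : Fin s → MvPolynomial (Fin n) π.ring) :
    ((Ideal.Quotient.mk Q).comp (MvPolynomial.subst fun i => π.redPoly _ (T' i))).comp
      (π.redPoly _) = (π.toQuotient hQ).comp
      ((Ideal.Quotient.mk (P.comap (π.incl _))).comp (MvPolynomial.subst T')) := by
  rw [RingHom.comp_assoc, ← MvPolynomial.map_comp_subst]
  rfl

theorem isIntegral_comp_subst_red (π : Place K) {T' : Fin s → MvPolynomial (Fin n) π.ring}
    (hi : ((Ideal.Quotient.mk (P.comap (π.incl _))).comp (MvPolynomial.subst T')).IsIntegral)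
    {Q : Ideal (MvPolynomial (Fin n) π.res)} (hQ : π.sp P ≤ Q) :
    ((Ideal.Quotient.mk Q).comp
      (MvPolynomial.subst fun i => π.redPoly _ (T' i))).IsIntegral := by
  intro x
  obtain ⟨x, rfl⟩ := Ideal.Quotient.mk_surjective x
  obtain ⟨x, rfl⟩ := π.redPoly_surjective x
  exact RingHom.IsIntegralElem.of_square (B := MvPolynomial (Fin n) π.ring ⧸ P.comap (π.incl _))
    (e := π.toQuotient hQ) (π.toQuotient_comp hQ T')
    (hi (Ideal.Quotient.mk _ x))

theorem ker_redPoly_le (π : Place K) {s : ℕ} {T' : Fin s → MvPolynomial (Fin n) π.ring}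
    {𝔮 : Ideal (MvPolynomial (Fin n) π.ring)}
    (h : RingHom.ker (π.redPoly (Fin s)) ≤ 𝔮.comap (MvPolynomial.subst T')) :
    RingHom.ker (π.redPoly (Fin n)) ≤ 𝔮 := by
  rw [MvPolynomial.ker_map, Ideal.map_le_iff_le_comap]
  intro a ha
  have : MvPolynomial.C a ∈ RingHom.ker (π.redPoly (Fin s)) := by
    rw [RingHom.mem_ker, MvPolynomial.map_C, RingHom.mem_ker.1 ha, map_zero]
  simpa using h this

theorem sp_ne_top (π : Place K) {T' : Fin s → MvPolynomial (Fin n) π.ring}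
    (hT : Function.Injective
      ((Ideal.Quotient.mk (P.comap (π.incl _))).comp (MvPolynomial.subst T')))
    (hi : ((Ideal.Quotient.mk (P.comap (π.incl _))).comp (MvPolynomial.subst T')).IsIntegral) :
    π.sp P ≠ ⊤ := by
  have hp : (RingHom.ker (π.redPoly (Fin s))).IsPrime := RingHom.ker_isPrime _
  obtain ⟨𝔮, h𝔮, h𝔮'⟩ := RingHom.exists_isPrime_comap_eq
    (B := MvPolynomial (Fin n) π.ring ⧸ P.comap (π.incl _)) _ hT hi
    (RingHom.ker (π.redPoly (Fin s)))
  have hker := π.ker_redPoly_le (T' := T') (𝔮 := 𝔮.comap (Ideal.Quotient.mk _)) h𝔮'.ge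
  intro htop
  obtain ⟨g, hg, hg1⟩ := mem_sp.1 (htop ▸ Submodule.mem_top : 1 ∈ π.sp P)
  refine (h𝔮.comap (Ideal.Quotient.mk _)).ne_top ((Ideal.eq_top_iff_one _).2 ?_)
  have h1 : g - 1 ∈ 𝔮.comap (Ideal.Quotient.mk (P.comap (π.incl _))) :=
    hker (by rw [RingHom.mem_ker, map_sub, hg1, map_one, sub_self])
  have h2 : g ∈ 𝔮.comap (Ideal.Quotient.mk (P.comap (π.incl _))) := by
    rw [Ideal.mem_comap, Ideal.Quotient.eq_zero_iff_mem.2 (Ideal.mem_comap.2 hg)]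
    exact zero_mem _
  simpa using sub_mem h2 h1

theorem injective_comp_subst_red (π : Place K) [P.IsPrime]
    {T' : Fin s → MvPolynomial (Fin n) π.ring}
    (hT : Function.Injective
      ((Ideal.Quotient.mk (P.comap (π.incl _))).comp (MvPolynomial.subst T')))
    (hi : ((Ideal.Quotient.mk (P.comap (π.incl _))).comp (MvPolynomial.subst T')).IsIntegral)
    {Q : Ideal (MvPolynomial (Fin n) π.res)} (hQ : Q ∈ (π.sp P).minimalPrimes) :
    Function.Injective ((Ideal.Quotient.mk Q).comp
      (MvPolynomial.subst fun i => π.redPoly _ (T' i))) := by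
  have hclosed : IsIntegrallyClosed (MvPolynomial (Fin s) π.ring) :=
    MvPolynomial.isIntegrallyClosed_fin s
  exact RingHom.injective_comp_of_mem_minimalPrimes_map hT hi π.redPoly_surjective
    π.redPoly_surjective (MvPolynomial.map_comp_subst T' π.red).symm
    (fun 𝔮 h => π.ker_redPoly_le h) hQ

theorem eventually_isIntegral
    (hi : ((Ideal.Quotient.mk P).comp (MvPolynomial.subst T)).IsIntegral) :
    ∀ᶠ π in generic K, ∀ T' : Fin s → MvPolynomial (Fin n) π.ring, (∀ i, π.incl _ (T' i) = T i) →
      ((Ideal.Quotient.mk (P.comap (π.incl _))).comp (MvPolynomial.subst T')).IsIntegral := by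
  choose p hp hp0 using fun i => hi (Ideal.Quotient.mk P (MvPolynomial.X i))
  filter_upwards [eventually_all.2 fun i => eventually_mem_lifts (p i)] with π h T' hT'
  refine MvPolynomial.isIntegral_quotient_of_forall_X _ (fun a => ?_) fun i => ?_
  · have := ((Ideal.Quotient.mk (P.comap (π.incl _))).comp
      (MvPolynomial.subst T')).isIntegralElem_map (x := MvPolynomial.C a)
    rwa [RingHom.comp_apply, MvPolynomial.subst_C] at this
  · obtain ⟨q, hq, -, hqm⟩ := Polynomial.lifts_and_degree_eq_and_monic (h i) (hp i)
    refine ⟨q, hqm, Ideal.quotientMap_injective (I := P) (f := π.incl _) ?_⟩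
    rw [Polynomial.hom_eval₂, map_zero, ← hp0 i, ← hq, Polynomial.eval₂_map]
    congr 1
    · rw [RingHom.comp_assoc, ← funext hT', ← MvPolynomial.map_comp_subst]
      rfl
    · simp

end Normalization

end Place

namespace MvPolynomial

variable {τ V R S : Type*} [CommRing R] [CommRing S]

/-- The polynomial with independent variables as coefficients. -/
noncomputable def generic (R : Type*) [CommRing R] (M : Finset (τ →₀ ℕ)) (j : M → V) :
    MvPolynomial τ (MvPolynomial V R) :=
  ∑ a : M, monomial a.1 (X (j a))

theorem map_generic (M : Finset (τ →₀ ℕ)) (j : M → V) (φ : R →+* S) :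
    map (map φ) (generic R M j) = generic S M j := by
  simp [generic, map_sum]

theorem map_eval_generic (M : Finset (τ →₀ ℕ)) (j : M → V) (x : V → R) :
    map (eval x) (generic R M j) = ∑ a : M, monomial a.1 (x (j a)) := by
  simp [generic, map_sum]

theorem sum_monomial_coeff {M : Finset (τ →₀ ℕ)} {g : MvPolynomial τ R} (hg : g.support ⊆ M) :
    ∑ a : M, monomial a.1 (coeff a.1 g) = g := by
  rw [Finset.sum_coe_sort M fun a => monomial a (coeff a g)]
  conv_rhs => rw [g.as_sum]
  exact (Finset.sum_subset hg fun a _ ha => by rw [notMem_support_iff.1 ha, map_zero]).symm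

/-- The equations expressing that a given polynomial is a product of two polynomials with
monomials in a given set are the coefficients of this polynomial. -/
noncomputable def factorDefect (M : Finset (τ →₀ ℕ)) (f : MvPolynomial τ R) :
    MvPolynomial τ (MvPolynomial (M ⊕ M) R) :=
  generic R M Sum.inl * generic R M Sum.inr - map C f

theorem map_factorDefect (M : Finset (τ →₀ ℕ)) (φ : R →+* S) (f : MvPolynomial τ R) :
    map (map φ) (factorDefect M f) = factorDefect M (map φ f) := by
  rw [factorDefect, map_sub, map_mul, map_generic, map_generic, factorDefect, map_map, map_map]
  congr 3
  ext a
  simp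

theorem map_eval_factorDefect (M : Finset (τ →₀ ℕ)) (f : MvPolynomial τ R) (x : M ⊕ M → R) :
    map (eval x) (factorDefect M f) = (∑ a : M, monomial a.1 (x (Sum.inl a))) *
      (∑ a : M, monomial a.1 (x (Sum.inr a))) - f := by
  rw [factorDefect, map_sub, map_mul, map_eval_generic, map_eval_generic, map_map]
  congr 1
  convert map_id f
  ext a
  simp

theorem totalDegree_lt_of_mul {K : Type*} [Field K] {g h : MvPolynomial τ K} (hgh : g * h ≠ 0)
    (hh : ¬ IsUnit h) : g.totalDegree < (g * h).totalDegree := by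
  have h0 := right_ne_zero_of_mul hgh
  rw [totalDegree_mul_of_isDomain (left_ne_zero_of_mul hgh) h0]
  suffices h.totalDegree ≠ 0 by omega
  intro hd
  refine hh (isUnit_iff_totalDegree_of_isReduced.2 ⟨?_, hd⟩)
  rw [totalDegree_eq_zero_iff_eq_C] at hd
  rw [isUnit_iff_ne_zero]
  intro hc
  rw [hc, map_zero] at hd
  exact h0 hd

theorem span_coeff_factorDefect_eq_top {K : Type*} [Field K] [IsAlgClosed K]
    {f : MvPolynomial τ K} (hf : Irreducible f) {M : Finset (τ →₀ ℕ)}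
    (hM : ∀ d ∈ M, d.degree < f.totalDegree) :
    Ideal.span (Set.range fun d => coeff d (factorDefect M f)) = ⊤ := by
  classical
  rw [← Ideal.radical_eq_top, ← vanishingIdeal_zeroLocus_eq_radical (K := K),
    Ideal.eq_top_iff_one]
  intro x hx
  exfalso
  have h0 : map (eval x) (factorDefect M f) = 0 := by
    ext d
    rw [coeff_map, coeff_zero]
    exact hx _ (Ideal.subset_span ⟨d, rfl⟩)
  rw [map_eval_factorDefect, sub_eq_zero] at h0
  have hlt : ∀ y : M → K, (∑ a : M, monomial a.1 (y a)).totalDegree < f.totalDegree := by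
    intro y
    refine (totalDegree_finsetSum _ _).trans_lt ((Finset.sup_lt_iff ?_).2 fun a _ =>
      (totalDegree_monomial_le _ _).trans_lt (hM a.1 a.2))
    rw [bot_eq_zero, Nat.pos_iff_ne_zero]
    intro hd
    rw [totalDegree_eq_zero_iff_eq_C] at hd
    refine hf.not_isUnit (hd ▸ (isUnit_iff_ne_zero.2 fun hc => hf.ne_zero ?_).map C)
    rw [hd, hc, map_zero]
  have hu : ∀ y z : M → K, (∑ a : M, monomial a.1 (y a)) * (∑ a : M, monomial a.1 (z a)) = f →
      ¬ IsUnit (∑ a : M, monomial a.1 (y a)) := by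
    intro y z hyz hu
    have := totalDegree_mul (∑ a : M, monomial a.1 (y a)) (∑ a : M, monomial a.1 (z a))
    rw [hyz, (isUnit_iff_totalDegree_of_isReduced.1 hu).2] at this
    have := hlt z
    omega
  rcases hf.isUnit_or_isUnit h0.symm with h | h
  · exact hu _ _ h0 h
  · exact hu _ _ ((mul_comm _ _).trans h0) h

theorem span_coeff_factorDefect_ne_top [Nontrivial R] {g h : MvPolynomial τ R}
    {M : Finset (τ →₀ ℕ)} (hg : g.support ⊆ M) (hh : h.support ⊆ M) :
    Ideal.span (Set.range fun d => coeff d (factorDefect M (g * h))) ≠ ⊤ := by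
  let x : M ⊕ M → R := Sum.elim (fun a => coeff a.1 g) fun a => coeff a.1 h
  have h0 : map (eval x) (factorDefect M (g * h)) = 0 := by
    rw [map_eval_factorDefect]
    simp only [x, Sum.elim_inl, Sum.elim_inr]
    rw [sum_monomial_coeff hg, sum_monomial_coeff hh, sub_self]
  have hle : Ideal.span (Set.range fun d => coeff d (factorDefect M (g * h))) ≤
      RingHom.ker (eval x) := by
    rw [Ideal.span_le]
    rintro _ ⟨d, rfl⟩
    rw [SetLike.mem_coe, RingHom.mem_ker, ← coeff_map, h0, coeff_zero]
  intro htop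
  exact RingHom.ker_ne_top (eval x) (top_le_iff.1 (htop ▸ hle))

theorem map_finSuccEquiv (φ : R →+* S) {s : ℕ} (g : MvPolynomial (Fin (s + 1)) R) :
    (finSuccEquiv R s g).map (map φ) = finSuccEquiv S s (map φ g) := by
  have : (Polynomial.mapRingHom (map φ)).comp (finSuccEquiv R s).toRingEquiv.toRingHom =
      (finSuccEquiv S s).toRingEquiv.toRingHom.comp (map φ) := by
    refine ringHom_ext (fun a => ?_) fun i => ?_
    · simp [finSuccEquiv_apply]
    · refine Fin.cases ?_ (fun j => ?_) i
      · simp [finSuccEquiv_X_zero]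
      · simp [finSuccEquiv_X_succ]
  exact RingHom.congr_fun this g

theorem map_finSuccEquiv_symm (φ : R →+* S) {s : ℕ} (g : Polynomial (MvPolynomial (Fin s) R)) :
    map φ ((finSuccEquiv R s).symm g) = (finSuccEquiv S s).symm (g.map (map φ)) := by
  obtain ⟨g, rfl⟩ := (finSuccEquiv R s).surjective g
  rw [AlgEquiv.symm_apply_apply, map_finSuccEquiv, AlgEquiv.symm_apply_apply]

end MvPolynomial

namespace Place

variable {K : Type*} [Field K]

/-- An irreducible polynomial over an algebraically closed field has irreducible reduction at
generic places. -/
theorem eventually_irreducible [IsAlgClosed K] {τ : Type*} [Finite τ] {f : MvPolynomial τ K}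
    (hf : Irreducible f) :
    ∀ᶠ π in generic K, ∀ f', π.incl τ f' = f → Irreducible (π.redPoly τ f') := by
  classical
  let M : Finset (τ →₀ ℕ) := (Finsupp.finite_of_degree_lt f.totalDegree).toFinset
  have hM : ∀ d, d ∈ M ↔ d.degree < f.totalDegree := fun d => Set.Finite.mem_toFinset _
  have htop := MvPolynomial.span_coeff_factorDefect_eq_top hf fun d => (hM d).1
  obtain ⟨d, hd, hd0⟩ : ∃ d, d ≠ 0 ∧ f.coeff d ≠ 0 := by
    by_contra! hcon
    have hC : f = MvPolynomial.C (f.coeff 0) := by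
      ext d
      rw [MvPolynomial.coeff_C]
      split_ifs with h
      · rw [h]
      · exact hcon d (Ne.symm h)
    refine hf.not_isUnit (hC ▸ (isUnit_iff_ne_zero.2 fun hc => hf.ne_zero ?_).map MvPolynomial.C)
    rw [hC, hc, map_zero]
  filter_upwards [eventually_lift_mem_span ((Ideal.eq_top_iff_one _).1 htop),
    eventually_red_ne_zero hd0] with π h1 h2 f' hf'
  have hne : (π.redPoly τ f').coeff d ≠ 0 := by
    rw [MvPolynomial.coeff_map]
    refine h2 _ ?_
    rw [← hf', MvPolynomial.coeff_map]
    rfl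
  have hne0 : π.redPoly τ f' ≠ 0 := fun h => hne (by rw [h, MvPolynomial.coeff_zero])
  have hdeg : (π.redPoly τ f').totalDegree ≤ f.totalDegree := by
    rw [← hf']
    exact Finset.sup_mono ((MvPolynomial.support_map_subset _ _).trans
      (MvPolynomial.support_map_of_injective f' (f := π.ring.subtype) Subtype.val_injective).ge)
  have htop' : Ideal.span (Set.range fun d =>
      MvPolynomial.coeff d (MvPolynomial.factorDefect M (π.redPoly τ f'))) = ⊤ := by
    obtain ⟨g, hg, hg1⟩ := h1 (fun d => MvPolynomial.coeff d (MvPolynomial.factorDefect M f'))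
      fun d => by rw [← MvPolynomial.coeff_map, MvPolynomial.map_factorDefect, hf']
    have : g = 1 := π.incl_injective (hg1.trans (map_one _).symm)
    have := Ideal.mem_map_of_mem (π.redPoly _) (this ▸ hg)
    rw [map_one, Ideal.map_span, ← Set.range_comp] at this
    rw [Ideal.eq_top_iff_one]
    convert this using 4
    rw [← MvPolynomial.map_factorDefect, MvPolynomial.coeff_map]
    rfl
  have hsupp : ∀ g h : MvPolynomial τ π.res, π.redPoly τ f' = g * h → ¬ IsUnit h →
      g.support ⊆ M := by
    intro g h hgh hh a ha
    refine (hM a).2 ((MvPolynomial.le_totalDegree ha).trans_lt ?_)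
    exact (MvPolynomial.totalDegree_lt_of_mul (hgh ▸ hne0) hh).trans_le (hgh ▸ hdeg)
  refine ⟨fun hu => hne ?_, fun g h hgh => ?_⟩
  · rw [MvPolynomial.totalDegree_eq_zero_iff_eq_C.1
      (MvPolynomial.isUnit_iff_totalDegree_of_isReduced.1 hu).2, MvPolynomial.coeff_C,
      if_neg hd.symm]
  · by_contra! hcon
    rw [hgh] at htop'
    exact MvPolynomial.span_coeff_factorDefect_ne_top (hsupp g h hgh hcon.2)
      (hsupp h g (hgh.trans (mul_comm _ _)) hcon.1) htop'

theorem eventually_irreducible_polynomial [IsAlgClosed K] {s : ℕ}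
    {f : Polynomial (MvPolynomial (Fin s) K)} (hf : Irreducible f) :
    ∀ᶠ π in generic K, ∀ f', Polynomial.map (π.incl _) f' = f →
      Irreducible (Polynomial.map (π.redPoly _) f') := by
  have := (MulEquiv.irreducible_iff (MvPolynomial.finSuccEquiv K s).symm).2 hf
  filter_upwards [eventually_irreducible this] with π h f' hf'
  rw [← MulEquiv.irreducible_iff (MvPolynomial.finSuccEquiv π.res s).symm]
  have h2 := h ((MvPolynomial.finSuccEquiv π.ring s).symm f')
    (by rw [← hf']; exact MvPolynomial.map_finSuccEquiv_symm _ _)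
  exact MvPolynomial.map_finSuccEquiv_symm π.red f' ▸ h2

end Place

theorem RingHom.IsIntegral.exists_primitive {A B : Type*} [CommRing A] [IsDomain A]
    [IsIntegrallyClosed A] [CharZero A] [CommRing B] [IsDomain B] (h : A →+* B)
    (hinj : Function.Injective h) (hi : h.IsIntegral) (hf : h.FiniteType) :
    ∃ (y : B) (f : Polynomial A), f.Monic ∧ Irreducible f ∧ f.eval₂ h y = 0 ∧
      ∀ x, ∃ (c : A) (q : Polynomial A), c ≠ 0 ∧ h c * x = q.eval₂ h y := by
  have hfin := hi.to_finite hf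
  let := h.toAlgebra
  have : Algebra.IsIntegral A B := ⟨hi⟩
  have : FaithfulSMul A B := (faithfulSMul_iff_algebraMap_injective A B).2 hinj
  have : Module.Finite A B := hfin
  let E := FractionRing A
  let L := FractionRing B
  let := FractionRing.liftAlgebra A L
  have : IsScalarTower A E L := FractionRing.isScalarTower_liftAlgebra A L
  have : FiniteDimensional E L :=
    inferInstanceAs (FiniteDimensional (FractionRing A) (FractionRing B))
  have : CharZero E := charZero_of_injective_algebraMap (IsFractionRing.injective A E)
  have hAL (a : A) : algebraMap E L (algebraMap A E a) = algebraMap B L (h a) :=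
    (IsScalarTower.algebraMap_apply A E L a).symm.trans (IsScalarTower.algebraMap_apply A B L a)
  obtain ⟨α, hα⟩ := Field.exists_primitive_element E L
  obtain ⟨⟨y, ⟨_, a, ha, rfl⟩⟩, hy⟩ :=
    IsLocalization.surj (Algebra.algebraMapSubmonoid B (nonZeroDivisors A)) α
  have ha0 : algebraMap A E a ≠ 0 := by
    simpa using nonZeroDivisors.ne_zero ha
  have hy' : algebraMap B L y = α * algebraMap E L (algebraMap A E a) := by
    rw [hAL]
    exact hy.symm
  have hytop : IntermediateField.adjoin E {algebraMap B L y} = ⊤ := by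
    rw [eq_top_iff, ← hα, IntermediateField.adjoin_simple_le_iff]
    have h1 := IntermediateField.mem_adjoin_simple_self E (algebraMap B L y)
    have h2 := (IntermediateField.adjoin E {algebraMap B L y}).algebraMap_mem (algebraMap A E a)
    have h3 : α = algebraMap B L y / algebraMap E L (algebraMap A E a) := by
      rw [hy', mul_div_cancel_right₀]
      simpa using ha0
    rw [h3]
    exact div_mem h1 h2
  have hyi : _root_.IsIntegral A y := Algebra.IsIntegral.isIntegral y
  refine ⟨y, minpoly A y, minpoly.monic hyi, minpoly.irreducible hyi, minpoly.aeval A y,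
    fun x => ?_⟩
  have hx : algebraMap B L x ∈ Algebra.adjoin E {algebraMap B L y} := by
    rw [← IntermediateField.adjoin_simple_toSubalgebra_of_isAlgebraic
      (Algebra.IsAlgebraic.isAlgebraic _), hytop]
    trivial
  rw [Algebra.adjoin_singleton_eq_range_aeval] at hx
  obtain ⟨p, hp⟩ := hx
  obtain ⟨c, hc, hcp⟩ := IsLocalization.integerNormalization_spec (nonZeroDivisors A) p
  refine ⟨c, IsLocalization.integerNormalization (nonZeroDivisors A) p,
    nonZeroDivisors.ne_zero hc, IsFractionRing.injective B L ?_⟩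
  have := congrArg (Polynomial.aeval (algebraMap B L y)) hcp
  rw [Polynomial.aeval_map_algebraMap, Polynomial.aeval_algebraMap_apply] at this
  refine Eq.trans ?_ this.symm
  have hp' : Polynomial.aeval (algebraMap B L y) p = algebraMap B L x := hp
  rw [map_mul, ← algebraMap_smul E, map_smul, hp', Algebra.smul_def, hAL]

theorem RingHom.eval₂_eq_zero_iff_dvd {A B : Type*} [CommRing A] [IsDomain A]
    [IsIntegrallyClosed A] [CommRing B] [IsDomain B] (h : A →+* B)
    (hinj : Function.Injective h) {f : Polynomial A} (hm : f.Monic) (hf : Irreducible f) {y : B}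
    (hy : f.eval₂ h y = 0) (g : Polynomial A) : g.eval₂ h y = 0 ↔ f ∣ g := by
  let := h.toAlgebra
  have : FaithfulSMul A B := (faithfulSMul_iff_algebraMap_injective A B).2 hinj
  have hyi : _root_.IsIntegral A y := ⟨f, hm, hy⟩
  have h1 := (minpoly.isIntegrallyClosed_dvd_iff hyi f).1 hy
  have h2 := (associated_of_dvd_dvd h1 ((hf.dvd_iff.1 h1).resolve_left (minpoly.not_isUnit A y)).dvd)
  rw [← h2.dvd_iff_dvd_left]
  exact minpoly.isIntegrallyClosed_dvd_iff hyi g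

theorem RingHom.IsIntegral.exists_ne_zero_dvd {A B : Type*} [CommRing A] [IsDomain A]
    [CommRing B] [IsDomain B] (h : A →+* B) (hinj : Function.Injective h) (hi : h.IsIntegral)
    {b : B} (hb : b ≠ 0) : ∃ a, a ≠ 0 ∧ b ∣ h a := by
  let := h.toAlgebra
  have : FaithfulSMul A B := (faithfulSMul_iff_algebraMap_injective A B).2 hinj
  have h1 : _root_.IsIntegral A b := hi b
  obtain ⟨a, ha, h2⟩ := h1.isAlgebraic.exists_nonzero_dvd (mem_nonZeroDivisors_of_ne_zero hb)
  exact ⟨a, ha, h2⟩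

namespace MvPolynomial

variable {k : Type*} [Field k] {n s : ℕ} {T : Fin s → MvPolynomial (Fin n) k}

theorem exists_multiple_eval₂_mem {Y : MvPolynomial (Fin n) k}
    {I : Ideal (MvPolynomial (Fin n) k)}
    (hX : ∀ i, ∃ c q, c ≠ 0 ∧ subst T c * X i - Polynomial.eval₂ (subst T) Y q ∈ I)
    (Z : MvPolynomial (Fin n) k) :
    ∃ c q, c ≠ 0 ∧ subst T c * Z - Polynomial.eval₂ (subst T) Y q ∈ I := by
  induction Z using MvPolynomial.induction_on with
  | C a => exact ⟨1, Polynomial.C (C a), one_ne_zero, by simp⟩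
  | add p p' hp hp' =>
    obtain ⟨c, q, hc, hq⟩ := hp
    obtain ⟨c', q', hc', hq'⟩ := hp'
    refine ⟨c * c', Polynomial.C c' * q + Polynomial.C c * q', mul_ne_zero hc hc', ?_⟩
    convert add_mem (I.mul_mem_left (subst T c') hq) (I.mul_mem_left (subst T c) hq') using 1
    simp only [map_mul, Polynomial.eval₂_add, Polynomial.eval₂_mul, Polynomial.eval₂_C]
    ring
  | mul_X p i hp =>
    obtain ⟨c, q, hc, hq⟩ := hp
    obtain ⟨c', q', hc', hq'⟩ := hX i
    refine ⟨c * c', q * q', mul_ne_zero hc hc', ?_⟩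
    convert add_mem (I.mul_mem_left (subst T c' * X i) hq)
      (I.mul_mem_left (Polynomial.eval₂ (subst T) Y q) hq') using 1
    simp only [map_mul, Polynomial.eval₂_mul]
    ring

theorem le_of_primitive {Y : MvPolynomial (Fin n) k} {I : Ideal (MvPolynomial (Fin n) k)}
    (hX : ∀ i, ∃ c q, c ≠ 0 ∧ subst T c * X i - Polynomial.eval₂ (subst T) Y q ∈ I)
    {f : Polynomial (MvPolynomial (Fin s) k)} (hm : f.Monic) (hf : Irreducible f)
    (hY : Polynomial.eval₂ (subst T) Y f ∈ I) {Q Q' : Ideal (MvPolynomial (Fin n) k)} [Q.IsPrime]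
    [Q'.IsPrime] (hQ : I ≤ Q) (hQ' : I ≤ Q')
    (hinj : Function.Injective ((Ideal.Quotient.mk Q).comp (subst T)))
    (hinj' : Function.Injective ((Ideal.Quotient.mk Q').comp (subst T))) : Q ≤ Q' := by
  have := isIntegrallyClosed_fin (R := k) s
  have key (Q : Ideal (MvPolynomial (Fin n) k)) [Q.IsPrime] (hQ : I ≤ Q)
      (hinj : Function.Injective ((Ideal.Quotient.mk Q).comp (subst T))) (q) :
      Polynomial.eval₂ (subst T) Y q ∈ Q ↔ f ∣ q := by
    rw [← RingHom.eval₂_eq_zero_iff_dvd _ hinj hm hf (y := Ideal.Quotient.mk Q Y) _ q,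
      ← Polynomial.hom_eval₂, Ideal.Quotient.eq_zero_iff_mem]
    rw [← Polynomial.hom_eval₂, Ideal.Quotient.eq_zero_iff_mem]
    exact hQ hY
  intro Z hZ
  obtain ⟨c, q, hc, hq⟩ := exists_multiple_eval₂_mem hX Z
  have h1 : Polynomial.eval₂ (subst T) Y q ∈ Q :=
    (Submodule.sub_mem_iff_right Q (Q.mul_mem_left _ hZ)).1 (hQ hq)
  have h2 := (key Q' hQ' hinj' q).2 ((key Q hQ hinj q).1 h1)
  have h3 := (Submodule.sub_mem_iff_left Q' h2).1 (hQ' hq)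
  refine (Ideal.IsPrime.mem_or_mem ‹_› h3).resolve_left fun h4 => hc ?_
  exact (injective_iff_map_eq_zero _).1 hinj' c (Ideal.Quotient.eq_zero_iff_mem.2 h4)

end MvPolynomial

namespace Place

variable {K : Type*} [Field K] {n : ℕ}

theorem eventually_lift_ne_zero {σ : Type*} {f : MvPolynomial σ K} (hf : f ≠ 0) :
    ∀ᶠ π in generic K, ∃ g, π.incl σ g = f ∧ π.redPoly σ g ≠ 0 := by
  filter_upwards [eventually_lift f, eventually_redPoly_ne_zero hf] with π ⟨g, hg⟩ h
  exact ⟨g, hg, h g hg⟩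

theorem eventually_minimalPrimes_sp_eq_singleton [CharZero K] [IsAlgClosed K]
    (P : Ideal (MvPolynomial (Fin n) K)) [P.IsPrime] :
    ∀ᶠ π in generic K, ∃ Q, (π.sp P).minimalPrimes = {Q} ∧
      ringKrullDim (MvPolynomial (Fin n) K ⧸ P) =
        ringKrullDim (MvPolynomial (Fin n) π.res ⧸ Q) := by
  obtain ⟨s, T, hT, hi⟩ := MvPolynomial.exists_noether_normalization
    (Ideal.IsPrime.ne_top ‹_› : P ≠ ⊤)
  have := MvPolynomial.isIntegrallyClosed_fin (R := K) s
  have hft : ((Ideal.Quotient.mk P).comp (MvPolynomial.subst T)).FiniteType := by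
    refine RingHom.FiniteType.of_comp_finiteType (f := MvPolynomial.C) ?_
    rw [RingHom.comp_assoc, show (MvPolynomial.subst T).comp MvPolynomial.C = MvPolynomial.C from
      RingHom.ext fun a => MvPolynomial.subst_C T a]
    refine RingHom.FiniteType.comp (RingHom.FiniteType.of_surjective _
      Ideal.Quotient.mk_surjective) ?_
    exact (RingHom.finiteType_algebraMap (A := K) (B := MvPolynomial (Fin n) K)).2 inferInstance
  obtain ⟨Y, f, hm, hf, hY, hX⟩ := RingHom.IsIntegral.exists_primitive _ hT hi hft
  obtain ⟨Y, rfl⟩ := Ideal.Quotient.mk_surjective Y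
  choose c q hc hq using fun i => hX (Ideal.Quotient.mk P (MvPolynomial.X i))
  rw [← Polynomial.hom_eval₂, Ideal.Quotient.eq_zero_iff_mem] at hY
  have hq' (i) : MvPolynomial.subst T (c i) * MvPolynomial.X i -
      Polynomial.eval₂ (MvPolynomial.subst T) Y (q i) ∈ P := by
    rw [← Ideal.Quotient.eq_zero_iff_mem, map_sub, map_mul, Polynomial.hom_eval₂, ← hq i,
      RingHom.comp_apply, sub_self]
  filter_upwards [eventually_all.2 fun i => eventually_lift (T i), eventually_lift Y,
    eventually_mem_lifts f, eventually_irreducible_polynomial hf,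
    eventually_all.2 fun i => eventually_lift_ne_zero (hc i),
    eventually_all.2 fun i => eventually_mem_lifts (q i), eventually_isIntegral hi]
    with π hπT hπY hπf hπf' hπc hπq hπi
  choose T' hT' using hπT
  obtain ⟨Y', rfl⟩ := hπY
  obtain ⟨f', hf', -, hfm'⟩ := Polynomial.lifts_and_degree_eq_and_monic hπf hm
  choose c' hc' hc'0 using hπc
  choose q' hq'' using hπq
  have hT'' := funext hT'
  have hinj := π.comp_subst_injective_of_lift hT hT'
  have hint := hπi T' hT'
  have hinc (g : Polynomial (MvPolynomial (Fin s) π.ring)) :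
      π.incl _ (Polynomial.eval₂ (MvPolynomial.subst T') Y' g) =
        Polynomial.eval₂ (MvPolynomial.subst T) (π.incl _ Y') (Polynomial.map (π.incl _) g) := by
    rw [Polynomial.hom_eval₂, Polynomial.eval₂_map, MvPolynomial.map_comp_subst, hT'']
  have hred (g : Polynomial (MvPolynomial (Fin s) π.ring)) :
      π.redPoly _ (Polynomial.eval₂ (MvPolynomial.subst T') Y' g) =
        Polynomial.eval₂ (MvPolynomial.subst fun i => π.redPoly _ (T' i)) (π.redPoly _ Y')
          (Polynomial.map (π.redPoly _) g) := by
    rw [Polynomial.hom_eval₂, Polynomial.eval₂_map, MvPolynomial.map_comp_subst]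
  have hY₁ : Polynomial.eval₂ (MvPolynomial.subst fun i => π.redPoly _ (T' i)) (π.redPoly _ Y')
      (Polynomial.map (π.redPoly _) f') ∈ π.sp P := by
    rw [← hred]
    exact redPoly_mem_sp (by rwa [hinc, hf'])
  have hX₁ (i) : ∃ c q, c ≠ 0 ∧ MvPolynomial.subst (fun i => π.redPoly _ (T' i)) c *
      MvPolynomial.X i - Polynomial.eval₂ (MvPolynomial.subst fun i => π.redPoly _ (T' i))
        (π.redPoly _ Y') q ∈ π.sp P := by
    refine ⟨π.redPoly _ (c' i), Polynomial.map (π.redPoly _) (q' i), hc'0 i, ?_⟩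
    rw [← hred, ← MvPolynomial.map_X π.red, ← MvPolynomial.map_subst, ← map_mul, ← map_sub]
    refine redPoly_mem_sp ?_
    rw [map_sub, hinc, map_mul, MvPolynomial.map_subst, hT'', hc', MvPolynomial.map_X]
    rw [show Polynomial.map (π.incl _) (q' i) = q i from hq'' i]
    exact hq' i
  obtain ⟨M, hM, hPM⟩ := Ideal.exists_le_maximal _ (π.sp_ne_top hinj hint)
  have := hM.isPrime
  obtain ⟨Q, hQ, -⟩ := Ideal.exists_minimalPrimes_le hPM
  refine ⟨Q, Set.eq_singleton_iff_unique_mem.2 ⟨hQ, fun Q' hQ' => ?_⟩, ?_⟩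
  · have := hQ.1.1
    have := hQ'.1.1
    have hle {Q Q' : Ideal _} (hQ : Q ∈ (π.sp P).minimalPrimes)
        (hQ' : Q' ∈ (π.sp P).minimalPrimes) : Q ≤ Q' :=
      have := hQ.1.1
      have := hQ'.1.1
      MvPolynomial.le_of_primitive hX₁ (hfm'.map _) (hπf' f' hf') hY₁ hQ.1.2 hQ'.1.2
        (π.injective_comp_subst_red hinj hint hQ) (π.injective_comp_subst_red hinj hint hQ')
    exact le_antisymm (hle hQ' hQ) (hle hQ hQ')
  · have := hQ.1.1
    rw [ringKrullDim_eq_of_injective_of_isIntegral_mvPolynomial _ hT hi,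
      ringKrullDim_eq_of_injective_of_isIntegral_mvPolynomial _
        (π.injective_comp_subst_red hinj hint hQ) (π.isIntegral_comp_subst_red hint hQ.1.2)]

theorem eventually_redPoly_notMem {P : Ideal (MvPolynomial (Fin n) K)} [P.IsPrime]
    {Z : MvPolynomial (Fin n) K} (hZ : Z ∉ P) :
    ∀ᶠ π in generic K, ∀ Z', π.incl _ Z' = Z → ∀ Q ∈ (π.sp P).minimalPrimes,
      π.redPoly _ Z' ∉ Q := by
  obtain ⟨s, T, hT, hi⟩ := MvPolynomial.exists_noether_normalization
    (Ideal.IsPrime.ne_top ‹_› : P ≠ ⊤)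
  obtain ⟨c, hc, W, hW⟩ := RingHom.IsIntegral.exists_ne_zero_dvd _ hT hi
    (mt Ideal.Quotient.eq_zero_iff_mem.1 hZ)
  obtain ⟨W, rfl⟩ := Ideal.Quotient.mk_surjective W
  rw [RingHom.comp_apply, ← map_mul, Ideal.Quotient.eq] at hW
  filter_upwards [eventually_all.2 fun i => eventually_lift (T i), eventually_lift W,
    eventually_lift_ne_zero hc, eventually_isIntegral hi] with π hπT ⟨W', hW'⟩ ⟨c', hc', hc0⟩ hπi
  choose T' hT' using hπT
  intro Z' hZ' Q hQ hZQ
  have hinj := π.injective_comp_subst_red (π.comp_subst_injective_of_lift hT hT') (hπi T' hT') hQ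
  refine hc0 ((injective_iff_map_eq_zero _).1 hinj _ (Ideal.Quotient.eq_zero_iff_mem.2 ?_))
  have h1 : π.redPoly _ (MvPolynomial.subst T' c' - Z' * W') ∈ π.sp P := redPoly_mem_sp (by
    rwa [map_sub, map_mul, MvPolynomial.map_subst, funext hT', hc', hZ', hW'])
  have h2 := hQ.1.2 h1
  rw [map_sub, map_mul, MvPolynomial.map_subst] at h2
  exact (Submodule.sub_mem_iff_left Q (Q.mul_mem_right _ hZQ)).1 h2

end Place

theorem MvPolynomial.map_map_intCastRingHom {R S σ : Type*} [CommRing R] [CommRing S]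
    (φ : R →+* S) (f : MvPolynomial σ ℤ) :
    MvPolynomial.map φ (MvPolynomial.map (Int.castRingHom R) f) =
      MvPolynomial.map (Int.castRingHom S) f := by
  rw [MvPolynomial.map_map, RingHom.eq_intCast' (φ.comp _)]

namespace Place

variable {K : Type*} [Field K] {n : ℕ}

theorem exists_minimalPrimes_sp_le (π : Place K) (J : Ideal (MvPolynomial (Fin n) K))
    (Q : Ideal (MvPolynomial (Fin n) π.res)) [Q.IsPrime] (hQ : π.sp J ≤ Q) :
    ∃ P ∈ J.minimalPrimes, π.sp P ≤ Q := by
  by_contra! h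
  have hfin := Ideal.finite_minimalPrimes_of_isNoetherianRing (MvPolynomial (Fin n) K) J
  have hex (P : Ideal (MvPolynomial (Fin n) K)) : ∃ g : MvPolynomial (Fin n) π.ring,
      P ∈ J.minimalPrimes → π.incl _ g ∈ P ∧ π.redPoly _ g ∉ Q := by
    by_cases hP : P ∈ J.minimalPrimes
    · obtain ⟨x, hx, hxQ⟩ := SetLike.not_le_iff_exists.1 (h P hP)
      obtain ⟨g, hg, rfl⟩ := mem_sp.1 hx
      exact ⟨g, fun _ => ⟨hg, hxQ⟩⟩
    · exact ⟨0, fun h => absurd h hP⟩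
  choose g hg using hex
  have hrad : π.incl _ (∏ P ∈ hfin.toFinset, g P) ∈ J.radical := by
    rw [← Ideal.sInf_minimalPrimes, Submodule.mem_sInf]
    intro P hP
    rw [map_prod, ← Finset.mul_prod_erase _ _ (hfin.mem_toFinset.2 hP)]
    exact Ideal.mul_mem_right _ P (hg P hP).1
  obtain ⟨N, hN⟩ := hrad
  rw [← map_pow] at hN
  have h1 := hQ (redPoly_mem_sp hN)
  rw [map_pow, map_prod] at h1
  obtain ⟨P, hP, h2⟩ := (Ideal.IsPrime.prod_mem_iff).1 (Ideal.IsPrime.mem_of_pow_mem ‹_› N h1)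
  exact (hg P (hfin.mem_toFinset.1 hP)).2 h2

theorem eventually_dimEquiv_sp [CharZero K] [IsAlgClosed K]
    (J : Ideal (MvPolynomial (Fin n) K)) : ∀ᶠ π in generic K, DimEquiv J (π.sp J) := by
  have hfin := Ideal.finite_minimalPrimes_of_isNoetherianRing (MvPolynomial (Fin n) K) J
  have h1 : ∀ᶠ π in generic K, ∀ P ∈ J.minimalPrimes, ∃ Q, (π.sp P).minimalPrimes = {Q} ∧
      ringKrullDim (MvPolynomial (Fin n) K ⧸ P) =
        ringKrullDim (MvPolynomial (Fin n) π.res ⧸ Q) :=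
    (eventually_all_finite hfin).2 fun P hP =>
      have := hP.1.1
      eventually_minimalPrimes_sp_eq_singleton P
  have h2 : ∀ᶠ π in generic K, ∀ P ∈ J.minimalPrimes, ∀ P' ∈ J.minimalPrimes, P ≠ P' →
      ∃ Z, π.incl _ Z ∈ P ∧ ∀ Q ∈ (π.sp P').minimalPrimes, π.redPoly _ Z ∉ Q := by
    refine (eventually_all_finite hfin).2 fun P hP => (eventually_all_finite hfin).2 fun P' hP' =>
      eventually_imp_distrib_left.2 fun hne => ?_
    have := hP'.1.1
    obtain ⟨Z, hZ, hZ'⟩ := SetLike.not_le_iff_exists.1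
      fun hle : P ≤ P' => hne (le_antisymm hle (hP'.2 hP.1 hle))
    filter_upwards [eventually_lift Z, eventually_redPoly_notMem hZ'] with π ⟨Y, hY⟩ h
    exact ⟨Y, by rwa [hY], h Y hY⟩
  filter_upwards [h1, h2] with π h1 h2
  have hrad {P : Ideal (MvPolynomial (Fin n) K)} {Q} (h : (π.sp P).minimalPrimes = {Q}) : (π.sp P).radical = Q := by
    rw [← Ideal.sInf_minimalPrimes, h, sInf_singleton]
  have hmem {P : Ideal (MvPolynomial (Fin n) K)} {Q} (h : (π.sp P).minimalPrimes = {Q}) :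
      Q ∈ (π.sp P).minimalPrimes := h ▸ Set.mem_singleton Q
  refine DimEquiv.of_forall_exists (fun P => (π.sp P).radical) (fun P hP => ?_)
    (fun Q hQ hJQ => ?_) (fun P hP P' hP' hle => ?_) fun P hP => ?_
  · obtain ⟨Q, hQ, -⟩ := h1 P hP
    refine ⟨?_, (π.sp_mono hP.1.2).trans Ideal.le_radical⟩
    rw [hrad hQ]
    exact (hmem hQ).1.1
  · obtain ⟨P, hP, hPQ⟩ := π.exists_minimalPrimes_sp_le J Q hJQ
    exact ⟨P, hP, hQ.radical_le_iff.2 hPQ⟩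
  · by_contra hne
    obtain ⟨Z, hZ, hZ'⟩ := h2 P hP P' hP' hne
    obtain ⟨Q, hQ, -⟩ := h1 P' hP'
    exact hZ' Q (hmem hQ) (hrad hQ ▸ hle (Ideal.le_radical (redPoly_mem_sp hZ)))
  · obtain ⟨Q, hQ, hd⟩ := h1 P hP
    rw [hd, hrad hQ]

theorem eventually_dimEquiv_of_int [CharZero K] [IsAlgClosed K] {ι : Type*} [Finite ι]
    (F : ι → MvPolynomial (Fin n) ℤ) : ∀ᶠ π in generic K,
      DimEquiv (Ideal.span (Set.range fun i => MvPolynomial.map (Int.castRingHom K) (F i)))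
        (Ideal.span (Set.range fun i => MvPolynomial.map (Int.castRingHom π.res) (F i))) := by
  filter_upwards [eventually_dimEquiv_sp (Ideal.span (Set.range fun i =>
      MvPolynomial.map (Int.castRingHom K) (F i))),
    eventually_sp_span fun i => MvPolynomial.map (Int.castRingHom K) (F i)] with π h h'
  have h2 := h' (fun i => MvPolynomial.map (Int.castRingHom π.ring) (F i)) fun i => MvPolynomial.map_map_intCastRingHom _ _
  simp only [redPoly, MvPolynomial.map_map_intCastRingHom] at h2
  rwa [h2] at h

end Place

theorem ValuationSubring.isAlgClosed_residueField {K : Type*} [Field K] [IsAlgClosed K]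
    (V : ValuationSubring K) : IsAlgClosed (IsLocalRing.ResidueField V) := by
  refine IsAlgClosed.of_exists_root _ fun f hf hirr => ?_
  have hl : f ∈ Polynomial.lifts (IsLocalRing.residue V) := by
    rw [Polynomial.lifts_iff_coeff_lifts]
    exact fun i => IsLocalRing.residue_surjective _
  obtain ⟨g, hg, hdeg, hgm⟩ := Polynomial.lifts_and_degree_eq_and_monic hl hf
  obtain ⟨x, hx⟩ := IsAlgClosed.exists_root (g.map (algebraMap V K)) (by
    rw [hgm.degree_map, hdeg]
    exact (Polynomial.degree_pos_of_irreducible hirr).ne')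
  obtain ⟨y, rfl⟩ := (IsIntegrallyClosed.isIntegral_iff (R := V) (x := x)).1
    ⟨g, hgm, by rwa [Polynomial.IsRoot.def, Polynomial.eval_map] at hx⟩
  refine ⟨IsLocalRing.residue V y, ?_⟩
  rw [← hg, Polynomial.eval_map, Polynomial.eval₂_at_apply]
  rw [Polynomial.IsRoot.def, Polynomial.eval_map, Polynomial.eval₂_at_apply] at hx
  rw [(injective_iff_map_eq_zero _).1 (IsFractionRing.injective V K) _ hx, map_zero]

namespace Place

theorem exists_natCast_eq_zero (K : Type) [Field K] [CharZero K] [IsAlgClosed K] {p : ℕ}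
    (hp : p.Prime) : ∃ π : Place K, (p : π.res) = 0 := by
  let A := (Int.castRingHom K).range
  have hI : Ideal.span {(p : A)} ≠ ⊤ := by
    rw [Ne, Ideal.span_singleton_eq_top]
    intro h
    obtain ⟨⟨_, n, rfl⟩, hn⟩ := isUnit_iff_exists_inv.1 h
    have h1 : (p : K) * (n : K) = 1 := congrArg A.subtype hn
    have h2 : (p : ℤ) * n = 1 := by exact_mod_cast h1
    have := Int.isUnit_iff.1 (IsUnit.of_mul_eq_one _ h2)
    have := hp.two_le
    lia
  obtain ⟨V, -, hV⟩ := Ideal.image_subset_nonunits_valuationSubring _ hI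
  have hpV : ((p : V) : K) ∈ V.nonunits :=
    hV ⟨p, Ideal.mem_span_singleton_self _, by simp⟩
  have := V.isAlgClosed_residueField
  refine ⟨⟨V, IsLocalRing.ResidueField V, IsLocalRing.residue V,
    IsLocalRing.residue_surjective⟩, ?_⟩
  rw [← map_natCast (IsLocalRing.residue V), IsLocalRing.residue_eq_zero_iff]
  exact ValuationSubring.coe_mem_nonunits_iff.1 hpV

theorem inv_mem_of_red_ne_zero {K : Type*} [Field K] (π : Place K) {x : π.ring}
    (hx : π.red x ≠ 0) : (x : K)⁻¹ ∈ π.ring := by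
  have := RingHom.ker_isMaximal_of_surjective π.red π.surjective_red
  have h : IsUnit x := by
    rw [← IsLocalRing.notMem_maximalIdeal, ← IsLocalRing.eq_maximalIdeal this]
    exact hx
  obtain ⟨y, hy⟩ := isUnit_iff_exists_inv.1 h
  rw [inv_eq_of_mul_eq_one_right (congrArg π.ring.subtype hy : (x : K) * y = 1)]
  exact y.2

theorem tendsto_generic {K : Type*} [Field K] [CharZero K] [Algebra ℚ K]
    [Algebra.IsAlgebraic ℚ K]
    (π : Nat.Primes → Place K) (hπ : ∀ p, ((p : ℕ) : (π p).res) = 0) :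
    Tendsto π cofinite (generic K) := by
  have : Algebra.IsAlgebraic ℤ K :=
    (IsFractionRing.comap_isAlgebraic_iff (A := ℤ) (K := ℚ) (C := K)).2 inferInstance
  refine tendsto_iInf.2 fun a => tendsto_principal.2 ?_
  obtain ⟨m, hm, hma⟩ :=
    (Algebra.IsAlgebraic.isAlgebraic (R := ℤ) a).exists_integral_multiple
  have hfin : {p : Nat.Primes | (p : ℤ) ∣ m}.Finite := by
    refine Set.Finite.of_finite_image (f := fun p : Nat.Primes => (p : ℕ)) ?_
      Subtype.val_injective.injOn
    refine (Nat.divisors m.natAbs).finite_toSet.subset ?_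
    rintro _ ⟨p, hp, rfl⟩
    simpa [hm] using Int.natCast_dvd.1 hp
  filter_upwards [hfin.compl_mem_cofinite] with p hp
  have h1 : (m : K) * a ∈ (π p).ring := by
    obtain ⟨y, hy⟩ := (IsIntegrallyClosed.isIntegral_iff (R := (π p).ring)).1 hma.tower_top
    rw [← zsmul_eq_mul, ← hy]
    exact y.2
  have h2 : (π p).red (m : (π p).ring) ≠ 0 := by
    have := CharP.charP_iff_prime_eq_zero p.2 |>.2 (hπ p)
    rw [map_intCast, Ne, CharP.intCast_eq_zero_iff _ (p : ℕ)]
    exact hp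
  have h3 := (π p).inv_mem_of_red_ne_zero h2
  convert mul_mem h3 h1 using 1
  have : (m : K) ≠ 0 := by exact_mod_cast hm
  simp [this]

end Place

theorem MvPolynomial.dimEquiv_of_ringHom {K L ι : Type*} [Field K] [IsAlgClosed K] [Field L]
    {n : ℕ} (φ : K →+* L) (F : ι → MvPolynomial (Fin n) ℤ) :
    DimEquiv (Ideal.span (Set.range fun i => map (Int.castRingHom K) (F i)))
      (Ideal.span (Set.range fun i => map (Int.castRingHom L) (F i))) := by
  let := φ.toAlgebra
  have h := dimEquiv_map_of_isAlgClosed (L := L)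
    (Ideal.span (Set.range fun i => map (Int.castRingHom K) (F i)))
  rw [Ideal.map_span, ← Set.range_comp] at h
  convert h using 4
  exact (map_map_intCastRingHom _ _).symm

set_option maxHeartbeats 1000000 in
/-- For all but finitely many primes `p`, there is a dimension-preserving bijection between
the minimal primes over the ideal generated by `F_1, …, F_m` in `ℂ[X_1, …, X_r]` and the
minimal primes over the ideal generated by their reductions mod `p` in `𝔽̄_p[X_1, …, X_r]`. -/
theorem base_change_of_irreducible_components
    (r m : ℕ) (F : Fin m → MvPolynomial (Fin r) ℤ) :
    {p : ℕ | ∃ _ : Fact p.Prime,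
      ¬ ∃ σ : (Ideal.span
            (Set.range fun i => MvPolynomial.map (Int.castRingHom ℂ) (F i))).minimalPrimes ≃
          (Ideal.span (Set.range fun i =>
            MvPolynomial.map (Int.castRingHom (AlgebraicClosure (ZMod p))) (F i))).minimalPrimes,
        ∀ P : (Ideal.span
            (Set.range fun i => MvPolynomial.map (Int.castRingHom ℂ) (F i))).minimalPrimes,
          ringKrullDim (MvPolynomial (Fin r) ℂ ⧸ P.1)
            = ringKrullDim (MvPolynomial (Fin r) (AlgebraicClosure (ZMod p)) ⧸ (σ P).1)}.Finite := by
  choose π hπ using fun p : Nat.Primes => Place.exists_natCast_eq_zero (AlgebraicClosure ℚ) p.2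
  have : Algebra.IsAlgebraic ℚ (AlgebraicClosure ℚ) := AlgebraicClosure.isAlgebraic ℚ
  have hfin := (Place.tendsto_generic π hπ).eventually (Place.eventually_dimEquiv_of_int F)
  rw [eventually_cofinite] at hfin
  refine (hfin.image (fun p : Nat.Primes => (p : ℕ))).subset ?_
  rintro p ⟨hp, hσ⟩
  refine ⟨⟨p, hp.out⟩, fun h => hσ ?_, rfl⟩
  have hchar : CharP (π ⟨p, hp.out⟩).res p :=
    (CharP.charP_iff_prime_eq_zero hp.out).2 (hπ ⟨p, hp.out⟩)
  let := ZMod.algebra (π ⟨p, hp.out⟩).res p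
  have hℂ := MvPolynomial.dimEquiv_of_ringHom
    (IsAlgClosed.lift : AlgebraicClosure ℚ →ₐ[ℚ] ℂ).toRingHom F
  have hp' := MvPolynomial.dimEquiv_of_ringHom
    (IsAlgClosed.lift : AlgebraicClosure (ZMod p) →ₐ[ZMod p] (π ⟨p, hp.out⟩).res).toRingHom F
  exact (hℂ.symm.trans h).trans hp'.symm
end

section
/- Let A be a subring of ℂ that is finitely generated as a ℤ-algebra. Then the set of prime numbers p for which there exists a ring homomorphism A → 𝔽_p (equivalently, a maximal ideal 𝔓 of A with A/𝔓 ≅ 𝔽_p) is infinite. -/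
open Polynomial in
/-- Schur's theorem: a nonconstant integer polynomial has roots modulo arbitrarily large primes. -/
theorem Polynomial.exists_prime_gt_exists_root_zmod (f : ℤ[X]) (hf : 0 < f.degree) (n : ℕ) :
    ∃ p : ℕ, n < p ∧ p.Prime ∧ ∃ r : ℤ, (p : ℤ) ∣ f.eval r := by
  by_cases hc : f.eval 0 = 0
  · obtain ⟨p, hp, hpp⟩ := Nat.exists_infinite_primes (n + 1)
    exact ⟨p, hp, hpp, 0, by simp [hc]⟩
  set c := f.eval 0
  have ne_C (a : ℤ) : f - C a ≠ 0 := fun h ↦ by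
    rw [sub_eq_zero.1 h] at hf
    exact absurd degree_C_le hf.not_ge
  have hm : c * (n.factorial : ℤ) ≠ 0 := mul_ne_zero hc (by exact_mod_cast n.factorial_ne_zero)
  obtain ⟨t, ht⟩ : ∃ t : ℤ,
      ((f - C 0) * (f - C c) * (f - C (-c))).eval (c * n.factorial * t) ≠ 0 := by
    by_contra! h
    have hne := mul_ne_zero (mul_ne_zero (ne_C 0) (ne_C c)) (ne_C (-c))
    refine Set.infinite_range_of_injective (mul_right_injective₀ hm)
      ((finite_setOfPred_isRoot hne).subset ?_)
    rintro _ ⟨t, rfl⟩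
    exact h t
  obtain ⟨k, hk⟩ := sub_dvd_eval_sub (c * n.factorial * t) 0 f
  have hy : f.eval (c * n.factorial * t) = c * (1 + n.factorial * t * k) := by
    linear_combination hk
  simp only [eval_mul, eval_sub, eval_C, hy] at ht
  have hy1 : (1 + n.factorial * t * k : ℤ).natAbs ≠ 1 := fun h ↦ by
    rcases Int.natAbs_eq_iff.1 h with h | h <;> simp [h] at ht
  obtain ⟨p, hp, hpy⟩ := Nat.exists_prime_and_dvd hy1
  rw [← Int.natCast_dvd] at hpy
  refine ⟨p, ?_, hp, _, hy ▸ hpy.mul_left c⟩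
  by_contra! hle
  have hpn : (p : ℤ) ∣ n.factorial := by exact_mod_cast hp.dvd_factorial.2 hle
  have : (p : ℤ) ∣ 1 := (Int.dvd_add_left ((hpn.mul_right t).mul_right k)).1 hpy
  exact hp.one_lt.ne' (by exact_mod_cast Int.eq_one_of_dvd_one (by positivity) this)

/-- A finite extension of `ℚ` has a primitive element that is integral over `ℤ`. -/
theorem exists_isIntegral_primitive_element (K : Type*) [Field K] [Algebra ℚ K]
    [FiniteDimensional ℚ K] : ∃ α : K, IsIntegral ℤ α ∧ Algebra.adjoin ℚ {α} = ⊤ := by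
  obtain ⟨β, hβ⟩ := Field.exists_primitive_element ℚ K
  have halg : IsAlgebraic ℤ β :=
    (IsFractionRing.isAlgebraic_iff ℤ ℚ K).2 (Algebra.IsAlgebraic.isAlgebraic β)
  obtain ⟨y, hy, hint⟩ := halg.exists_integral_multiple
  refine ⟨y • β, hint, ?_⟩
  have hβ' : Algebra.adjoin ℚ {β} = ⊤ := by
    rw [← IntermediateField.adjoin_simple_toSubalgebra_of_isAlgebraic
      (Algebra.IsAlgebraic.isAlgebraic β), hβ, IntermediateField.top_toSubalgebra]
  rw [eq_top_iff, ← hβ', Algebra.adjoin_le_iff, Set.singleton_subset_iff]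
  have : β = (y : ℚ)⁻¹ • (y • β) := by
    rw [← Int.cast_smul_eq_zsmul ℚ, inv_smul_smul₀ (by exact_mod_cast hy)]
  exact Set.mem_of_eq_of_mem this <|
    Subalgebra.smul_mem _ (Algebra.self_mem_adjoin_singleton ℚ (y • β)) _

/-- Elements of `ℚ[s]` have nonzero integer multiples in `ℤ[s]`. -/
theorem exists_zsmul_mem_adjoin_int {K : Type*} [Field K] [Algebra ℚ K] {s : Set K} {x : K}
    (hx : x ∈ Algebra.adjoin ℚ s) : ∃ N : ℤ, N ≠ 0 ∧ N • x ∈ Algebra.adjoin ℤ s := by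
  induction hx using Algebra.adjoin_induction with
  | mem x hx => exact ⟨1, one_ne_zero, by simpa using Algebra.subset_adjoin hx⟩
  | algebraMap r =>
    refine ⟨r.den, by simp, ?_⟩
    have : (r.den : ℤ) • algebraMap ℚ K r = algebraMap ℤ K r.num := by
      rw [zsmul_eq_mul, Int.cast_natCast, ← map_natCast (algebraMap ℚ K), ← map_mul,
        Rat.den_mul_eq_num]
      simp
    exact this ▸ Subalgebra.algebraMap_mem _ _
  | add x y _ _ hx hy =>
    obtain ⟨M, hM, hx⟩ := hx
    obtain ⟨N, hN, hy⟩ := hy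
    refine ⟨M * N, mul_ne_zero hM hN, ?_⟩
    have : (M * N) • (x + y) = N • (M • x) + M • (N • y) := by
      simp only [zsmul_eq_mul, Int.cast_mul]; ring
    exact this ▸ add_mem (Subalgebra.smul_mem _ hx _) (Subalgebra.smul_mem _ hy _)
  | mul x y _ _ hx hy =>
    obtain ⟨M, hM, hx⟩ := hx
    obtain ⟨N, hN, hy⟩ := hy
    refine ⟨M * N, mul_ne_zero hM hN, ?_⟩
    have : (M * N) • (x * y) = (M • x) * (N • y) := by
      simp only [zsmul_eq_mul, Int.cast_mul]; ring
    exact this ▸ mul_mem hx hy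

open Polynomial in
/-- An integral element `α` whose minimal polynomial has a root in `S` yields `ℤ[α] → S`. -/
theorem nonempty_adjoin_ringHom_of_minpoly_root {K S : Type*} [Field K] [CharZero K] [CommRing S]
    {α : K} (hα : IsIntegral ℤ α) {r : S} (hr : aeval r (minpoly ℤ α) = 0) :
    Nonempty (Algebra.adjoin ℤ {α} →+* S) :=
  ⟨(AdjoinRoot.lift (algebraMap ℤ S) r hr).comp
    (minpoly.equivAdjoin hα).symm.toAlgHom.toRingHom⟩

/-- A ring homomorphism from a subring `R` of a field `K` to a field extends to the subring of
fractions whose denominators are not sent to zero. -/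
theorem nonempty_ringHom_of_fractions {K F A : Type*} [Field K] [Field F] [CommRing A]
    (R : Subring K) (ψ : R →+* F) (φ : A →+* K) (s : Set A) (hs : Algebra.adjoin ℤ s = ⊤)
    (h : ∀ a ∈ s, ∃ N : ℤ, (N : F) ≠ 0 ∧ N • φ a ∈ R) : Nonempty (A →+* F) := by
  let P := RingHom.ker ψ
  have : P.IsPrime := RingHom.ker_isPrime ψ
  let O := (LocalSubring.ofPrime R P).toSubring
  have hRO : R ≤ O := LocalSubring.le_ofPrime R P
  have hφ (a : A) : φ a ∈ O := by
    have ha : a ∈ Algebra.adjoin ℤ s := hs ▸ Algebra.mem_top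
    induction ha using Algebra.adjoin_induction with
    | mem a ha =>
      obtain ⟨N, hN, hNa⟩ := h a ha
      have hNP : (N : R) ∈ P.primeCompl := fun h ↦ hN (by simpa [P] using h)
      obtain ⟨u, hu⟩ := (IsLocalization.map_units O ⟨(N : R), hNP⟩).exists_left_inv
      have hu' : (u : K) * N = 1 := by simpa using congrArg (Subtype.val : O → K) hu
      have : φ a = u * (N • φ a) := by rw [zsmul_eq_mul, ← mul_assoc, hu', one_mul]
      exact this ▸ mul_mem u.2 (hRO hNa)
    | algebraMap n => simp
    | add x y _ _ hx hy => exact map_add φ x y ▸ add_mem hx hy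
    | mul x y _ _ hx hy => exact map_mul φ x y ▸ mul_mem hx hy
  have hψ (y : P.primeCompl) : IsUnit (ψ y) := IsUnit.mk0 _ y.2
  exact ⟨(IsLocalization.lift (S := O) hψ).comp (φ.codRestrict O hφ)⟩

/-- A finitely generated ring mapping to a number field maps to `𝔽_p` for infinitely many `p`. -/
theorem infinite_setOf_prime_nonempty_ringHom_zmod {A K : Type*} [CommRing A]
    [Algebra.FiniteType ℤ A] [Field K] [Algebra ℚ K] [FiniteDimensional ℚ K] (φ : A →+* K) :
    {p : ℕ | p.Prime ∧ Nonempty (A →+* ZMod p)}.Infinite := by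
  have : CharZero K := algebraRat.charZero K
  obtain ⟨α, hα, htop⟩ := exists_isIntegral_primitive_element K
  obtain ⟨s, hs⟩ := (Algebra.FiniteType.out : (⊤ : Subalgebra ℤ A).FG)
  have hN (a : A) : ∃ N : ℤ, N ≠ 0 ∧ N • φ a ∈ Algebra.adjoin ℤ {α} :=
    exists_zsmul_mem_adjoin_int (htop ▸ Algebra.mem_top)
  choose N hN0 hN using hN
  refine Set.infinite_of_forall_exists_gt fun n ↦ ?_
  obtain ⟨p, hp, hpp, r, hr⟩ := (minpoly ℤ α).exists_prime_gt_exists_root_zmod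
    (minpoly.degree_pos hα) (n + ∑ a ∈ s, (N a).natAbs)
  have : Fact p.Prime := ⟨hpp⟩
  obtain ⟨ψ⟩ := nonempty_adjoin_ringHom_of_minpoly_root hα (S := ZMod p) (r := (r : ZMod p)) (by
    rwa [← eq_intCast (algebraMap ℤ (ZMod p)), Polynomial.aeval_algebraMap_apply,
      Polynomial.coe_aeval_eq_eval, eq_intCast, ZMod.intCast_zmod_eq_zero_iff_dvd])
  refine ⟨p, ⟨hpp, nonempty_ringHom_of_fractions
    (Algebra.adjoin ℤ {α}).toSubring ψ φ s hs fun a ha ↦ ⟨N a, fun h0 ↦ ?_, hN a⟩⟩,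
    by lia⟩
  rw [ZMod.intCast_zmod_eq_zero_iff_dvd, Int.natCast_dvd] at h0
  have h1 := Nat.le_of_dvd (Int.natAbs_pos.2 (hN0 a)) h0
  have h2 := Finset.single_le_sum (f := fun a ↦ (N a).natAbs) (fun _ _ ↦ Nat.zero_le _) ha
  lia

/-- For a finitely generated `ℤ`-subalgebra `A` of `ℂ`, the set of primes `p` admitting a
ring homomorphism `A → 𝔽_p` is infinite. -/
theorem infinitely_many_primes_with_hom_to_Fp
    (A : Subalgebra ℤ ℂ) (hA : A.FG) :
    {p : ℕ | p.Prime ∧ Nonempty (A →+* ZMod p)}.Infinite := by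
  have : Algebra.FiniteType ℤ A := A.fg_iff_finiteType.1 hA
  obtain ⟨s, hs⟩ := hA
  let B : Subalgebra ℚ ℂ := Algebra.adjoin ℚ s
  have : Algebra.FiniteType ℚ B := B.fg_iff_finiteType.1 ⟨s, rfl⟩
  have hAB : A ≤ B.restrictScalars ℤ := by
    rw [← hs, Algebra.adjoin_le_iff]
    exact Algebra.subset_adjoin
  obtain ⟨m, hm⟩ := Ideal.exists_maximal B
  let _ : Field (B ⧸ m) := Ideal.Quotient.field m
  have : Module.Finite ℚ (B ⧸ m) := finite_of_finite_type_of_isJacobsonRing ℚ (B ⧸ m)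
  exact infinite_setOf_prime_nonempty_ringHom_zmod
    ((Ideal.Quotient.mk m).comp (Subalgebra.inclusion hAB).toRingHom)
end

section
/- Let A be a subring of ℂ that is finitely generated as a ℤ-algebra. Then there exists a ring homomorphism from A to ℚ̄, the algebraic closure of ℚ. -/
open scoped TensorProduct

/-- Weak Nullstellensatz: a nontrivial finitely generated algebra over a field `K` has a point in
every algebraically closed extension of `K`. -/
theorem nonempty_algHom_of_finiteType (K B L : Type*) [Field K] [CommRing B] [Nontrivial B]
    [Algebra K B] [Algebra.FiniteType K B] [Field L] [Algebra K L] [IsAlgClosed L] :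
    Nonempty (B →ₐ[K] L) := by
  obtain ⟨m, hm⟩ := Ideal.exists_maximal B
  let _ := Ideal.Quotient.field m
  have : Module.Finite K (B ⧸ m) := finite_of_finite_type_of_isJacobsonRing K (B ⧸ m)
  exact ⟨(IsAlgClosed.lift (R := K) (S := B ⧸ m) (M := L)).comp (Ideal.Quotient.mkₐ K m)⟩

/-- Every finitely generated `ℤ`-subalgebra of `ℂ` admits a ring homomorphism to `ℚ̄`. -/
theorem exists_hom_to_algebraic_closure_of_rat
    (A : Subalgebra ℤ ℂ) (hA : A.FG) :
    Nonempty (A →+* AlgebraicClosure ℚ) := by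
  have : Algebra.FiniteType ℤ A := A.fg_iff_finiteType.mp hA
  let toComplex : ℚ ⊗[ℤ] A →ₐ[ℤ] ℂ :=
    Algebra.TensorProduct.productMap (algebraMap ℚ ℂ).toIntAlgHom A.val
  have : Nontrivial (ℚ ⊗[ℤ] A) := toComplex.toRingHom.domain_nontrivial
  obtain ⟨f⟩ := nonempty_algHom_of_finiteType ℚ (ℚ ⊗[ℤ] A) (AlgebraicClosure ℚ)
  exact ⟨f.toRingHom.comp (Algebra.TensorProduct.includeRight (R := ℤ) (A := ℚ) (B := A)).toRingHom⟩
end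

section
/- In the polynomial ring ℂ[X, Y] in two variables over ℂ, the ℂ-subalgebra generated by the three polynomials X² + X, XY + Y, and XY − Y² + Y is a proper subalgebra; that is, ℂ[X² + X, Y(X+1), Y(X − Y + 1)] ≠ ℂ[X, Y]. -/
open MvPolynomial

/-- In `ℂ[X, Y]`, the `ℂ`-subalgebra generated by `X² + X`, `XY + Y` and `XY − Y² + Y`
is a proper subalgebra. -/
theorem adjoin_three_polys_ne_top :
    Algebra.adjoin ℂ
        ({(X 0 : MvPolynomial (Fin 2) ℂ) ^ 2 + X 0,
          X 0 * X 1 + X 1,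
          X 0 * X 1 - X 1 ^ 2 + X 1} : Set (MvPolynomial (Fin 2) ℂ)) ≠ ⊤ := by
  intro h
  -- The generators do not separate the points `(0, 0)` and `(-1, 0)`, but `X` does.
  have hle := Algebra.adjoin_le (R := ℂ)
    (s := ({(X 0 : MvPolynomial (Fin 2) ℂ) ^ 2 + X 0,
      X 0 * X 1 + X 1, X 0 * X 1 - X 1 ^ 2 + X 1} : Set (MvPolynomial (Fin 2) ℂ)))
    (S := AlgHom.equalizer (aeval (![0, 0] : Fin 2 → ℂ)) (aeval ![-1, 0])) (by
      rintro p (rfl | rfl | rfl) <;> simp)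
  rw [h] at hle
  have hX : aeval (![0, 0] : Fin 2 → ℂ) (X 0 : MvPolynomial (Fin 2) ℂ) =
      aeval (![-1, 0] : Fin 2 → ℂ) (X 0) := hle Algebra.mem_top
  simp at hX
end
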